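/- Theorem 1: Assume conditions (A1), (A2), (A3). If τ_n² ⪯ n^{−3/2} q_n and ∫₀^∞ λ⁴ π(λ²) dλ² < ∞, then E₀ ‖E(K_n β_n | Y_n) − K_n β_{0n}‖² ⪯ q_n as n → ∞. -/

import Mathlib

open MeasureTheory Matrix Filter

noncomputable section

namespace RVM

/-- Squared Euclidean norm of a vector in `ℝⁿ`. -/
def sqnorm {n : ℕ} (v : Fin n → ℝ) : ℝ := v ⬝ᵥ v

/-- The hierarchical Bayesian relevance vector machine model (Model 1) of
Fang–Ghosh.  For each `n`, `K n` is a symmetric positive definite `n × n` kernel matrix,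
`β0 n` is the true coefficient vector, `σ0sq` the true error variance, `τsq n` the global
shrinkage parameter, `pr` the common prior density of the local parameters `λᵢ²` on `(0, ∞)`,
and `a, b` the hyperparameters of the inverse-gamma prior on `σ²`. -/
structure Model where
  K : (n : ℕ) → Matrix (Fin n) (Fin n) ℝ
  β0 : (n : ℕ) → Fin n → ℝ
  σ0sq : ℝ
  τsq : ℕ → ℝ
  pr : ℝ → ℝ
  a : ℝ
  b : ℝ
  hK : ∀ n, (K n).PosDef
  hσ0 : 0 < σ0sq
  ha : 0 < a
  hb : 0 < b
  hpr_nonneg : ∀ x, 0 ≤ pr x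
  hpr_supp : ∀ x ≤ 0, pr x = 0
  hpr_int : ∫ x in Set.Ioi (0 : ℝ), pr x = 1

namespace Model

variable (M : Model)

/-- `q n`: the number of nonzero entries of the true coefficient vector `β0 n`. -/
def q (n : ℕ) : ℕ := {i : Fin n | M.β0 n i ≠ 0}.ncard

/-- The unnormalized joint posterior density of `(β, σ², λ²)` given data `Y`:
`(σ²)^{−n−a/2−1} ∏ᵢ π(λᵢ²) · |Λ²|^{−1/2} ·
  exp[(−b − βᵀ τ⁻² Λ⁻² β − (Y − Kβ)ᵀ(Y − Kβ)) / (2σ²)]`. -/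
def jd (n : ℕ) (Y : Fin n → ℝ) (β : Fin n → ℝ) (s : ℝ) (l : Fin n → ℝ) : ℝ :=
  s ^ (-(n : ℝ) - M.a / 2 - 1) * (∏ i, M.pr (l i)) * (∏ i, l i) ^ (-(1 : ℝ) / 2) *
    Real.exp ((-M.b - (M.τsq n)⁻¹ * ∑ i, (β i) ^ 2 / l i
        - sqnorm (Y - M.K n *ᵥ β)) / (2 * s))

/-- The region `{(β, σ², λ²) : σ² > 0, λᵢ² > 0 ∀ i}` over which the posterior lives. -/
def posSet (n : ℕ) : Set ((Fin n → ℝ) × ℝ × (Fin n → ℝ)) :=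
  {p | 0 < p.2.1 ∧ ∀ i, 0 < p.2.2 i}

/-- Normalizing constant of the posterior given `Y`. -/
def Z (n : ℕ) (Y : Fin n → ℝ) : ℝ :=
  ∫ p in posSet n, M.jd n Y p.1 p.2.1 p.2.2

/-- Posterior mean `E(βₙ | Yₙ)` of the coefficient vector. -/
def postMean (n : ℕ) (Y : Fin n → ℝ) : Fin n → ℝ :=
  (M.Z n Y)⁻¹ • ∫ p in posSet n, M.jd n Y p.1 p.2.1 p.2.2 • p.1

/-- Posterior probability `P(βₙ ∈ E | Yₙ)`. -/
def postProb (n : ℕ) (Y : Fin n → ℝ) (E : Set (Fin n → ℝ)) : ℝ :=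
  (∫ p in posSet n ∩ {p | p.1 ∈ E}, M.jd n Y p.1 p.2.1 p.2.2) / M.Z n Y

/-- Trace of the posterior covariance matrix `V(βₙ | Yₙ)`,
i.e. `E(‖βₙ − E(βₙ|Yₙ)‖² | Yₙ)`. -/
def trPostVar (n : ℕ) (Y : Fin n → ℝ) : ℝ :=
  (M.Z n Y)⁻¹ * ∫ p in posSet n, M.jd n Y p.1 p.2.1 p.2.2 * sqnorm (p.1 - M.postMean n Y)

/-- Trace of the posterior covariance matrix `V(Kₙ βₙ | Yₙ)`,
i.e. `E(‖Kₙβₙ − Kₙ E(βₙ|Yₙ)‖² | Yₙ)`. -/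
def trPostVarK (n : ℕ) (Y : Fin n → ℝ) : ℝ :=
  (M.Z n Y)⁻¹ * ∫ p in posSet n,
    M.jd n Y p.1 p.2.1 p.2.2 * sqnorm (M.K n *ᵥ p.1 - M.K n *ᵥ M.postMean n Y)

/-- Density of the true data-generating distribution `N(Kₙ β₀ₙ, σ₀² Iₙ)`. -/
def trueDens (n : ℕ) (Y : Fin n → ℝ) : ℝ :=
  (2 * Real.pi * M.σ0sq) ^ (-(n : ℝ) / 2) *
    Real.exp (-sqnorm (Y - M.K n *ᵥ M.β0 n) / (2 * M.σ0sq))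

/-- Expectation `E₀` under the true data-generating distribution `Yₙ ~ N(Kₙ β₀ₙ, σ₀² Iₙ)`. -/
def E0 (n : ℕ) (f : (Fin n → ℝ) → ℝ) : ℝ :=
  ∫ Y, f Y * M.trueDens n Y

/-- Condition (A1): `c₁ Iₙ ≤ Kₙ ≤ c₂ Iₙ` for sufficiently large `n`, with constants
`0 < c₁ ≤ c₂` not depending on `n`. -/
def CondA1 : Prop :=
  ∃ c₁ c₂ : ℝ, 0 < c₁ ∧ c₁ ≤ c₂ ∧ ∃ N : ℕ, ∀ n ≥ N,
    (M.K n - c₁ • (1 : Matrix (Fin n) (Fin n) ℝ)).PosSemidef ∧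
      (c₂ • (1 : Matrix (Fin n) (Fin n) ℝ) - M.K n).PosSemidef

/-- Condition (A2): the true coefficients are uniformly bounded, `|β₀ₙ,ᵢ| < M₀` with `M₀`
independent of `n`. -/
def CondA2 : Prop := ∃ M₀ : ℝ, ∀ n, ∀ i : Fin n, |M.β0 n i| < M₀

/-- Condition (A3): `qₙ = o(n)`. -/
def CondA3 : Prop := Tendsto (fun n => (M.q n : ℝ) / n) atTop (nhds 0)

/-- Finite fourth moment of the prior: `∫ λ⁴ π(λ²) dλ² < ∞`. -/
def Moment4 : Prop := IntegrableOn (fun x => x ^ 2 * M.pr x) (Set.Ioi (0 : ℝ))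

/-- Finite inverse second moment of the prior: `∫ λ⁻² π(λ²) dλ² < ∞`. -/
def MomentNeg2 : Prop := IntegrableOn (fun x => x⁻¹ * M.pr x) (Set.Ioi (0 : ℝ))

end Model

end RVM

open scoped ENNReal

namespace RVM

section LinearAlgebra

variable {n : ℕ}

lemma sqnorm_eq_sum (v : Fin n → ℝ) : sqnorm v = ∑ i, v i ^ 2 := by
  simp [sqnorm, dotProduct, sq]

lemma sqnorm_nonneg (v : Fin n → ℝ) : 0 ≤ sqnorm v := by
  rw [sqnorm_eq_sum]; positivity

lemma sqnorm_pos {v : Fin n → ℝ} (hv : v ≠ 0) : 0 < sqnorm v := by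
  refine lt_of_le_of_ne (sqnorm_nonneg v) fun h => hv ?_
  exact dotProduct_self_eq_zero.1 h.symm

lemma sqnorm_smul (r : ℝ) (v : Fin n → ℝ) : sqnorm (r • v) = r ^ 2 * sqnorm v := by
  simp [sqnorm]; ring

lemma sqnorm_add (v w : Fin n → ℝ) : sqnorm (v + w) = sqnorm v + 2 * (v ⬝ᵥ w) + sqnorm w := by
  simp only [sqnorm, add_dotProduct, dotProduct_add, dotProduct_comm w v]; ring

lemma sqnorm_sub (v w : Fin n → ℝ) : sqnorm (v - w) = sqnorm v - 2 * (v ⬝ᵥ w) + sqnorm w := by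
  simp only [sqnorm, sub_dotProduct, dotProduct_sub, dotProduct_comm w v]; ring

lemma sqnorm_sub_le (v w : Fin n → ℝ) : sqnorm (v - w) ≤ 2 * sqnorm v + 2 * sqnorm w := by
  have := sqnorm_nonneg (v + w)
  rw [sqnorm_add] at this
  rw [sqnorm_sub]; linarith

lemma two_dotProduct_le (v w : Fin n → ℝ) : 2 * (v ⬝ᵥ w) ≤ sqnorm v + sqnorm w := by
  have := sqnorm_nonneg (v - w)
  rw [sqnorm_sub] at this; linarith

lemma dotProduct_mulVec_of_symm {K : Matrix (Fin n) (Fin n) ℝ} (hK : K.IsHermitian)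
    (v w : Fin n → ℝ) : v ⬝ᵥ K *ᵥ w = (K *ᵥ v) ⬝ᵥ w := by
  have h : Kᵀ = K := by simpa [IsHermitian, conjTranspose_eq_transpose_of_trivial] using hK
  rw [dotProduct_mulVec, ← mulVec_transpose, h]

/-- The conditional posterior precision matrix `K² + diag d` (up to the factor `σ⁻²`). -/
def prec (K : Matrix (Fin n) (Fin n) ℝ) (d : Fin n → ℝ) : Matrix (Fin n) (Fin n) ℝ :=
  K * K + diagonal d

/-- The conditional posterior mean `(K² + diag d)⁻¹ K Y`. -/
def condMean (K : Matrix (Fin n) (Fin n) ℝ) (d Y : Fin n → ℝ) : Fin n → ℝ :=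
  (prec K d)⁻¹ *ᵥ (K *ᵥ Y)

/-- The explained quadratic form `Yᵀ K (K² + diag d)⁻¹ K Y`. -/
def fitQ (K : Matrix (Fin n) (Fin n) ℝ) (d Y : Fin n → ℝ) : ℝ :=
  (K *ᵥ Y) ⬝ᵥ condMean K d Y

/-- The quadratic form of `K² + diag d`. -/
def precForm (K : Matrix (Fin n) (Fin n) ℝ) (d β : Fin n → ℝ) : ℝ :=
  sqnorm (K *ᵥ β) + ∑ i, d i * β i ^ 2

variable {K : Matrix (Fin n) (Fin n) ℝ} {d : Fin n → ℝ}

lemma dotProduct_prec (hK : K.IsHermitian) (v w : Fin n → ℝ) :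
    v ⬝ᵥ prec K d *ᵥ w = (K *ᵥ v) ⬝ᵥ (K *ᵥ w) + ∑ i, d i * v i * w i := by
  rw [prec, add_mulVec, dotProduct_add, ← mulVec_mulVec, dotProduct_mulVec_of_symm hK]
  congr 1
  simp only [dotProduct, mulVec_diagonal]
  exact Finset.sum_congr rfl fun i _ => by ring

lemma precForm_pos (hd : ∀ i, 0 < d i) {β : Fin n → ℝ} (hβ : β ≠ 0) : 0 < precForm K d β := by
  obtain ⟨i, hi⟩ := Function.ne_iff.1 hβ
  refine add_pos_of_nonneg_of_pos (sqnorm_nonneg _) ?_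
  refine Finset.sum_pos' (fun i _ => mul_nonneg (hd i).le (sq_nonneg _)) ⟨i, Finset.mem_univ _, ?_⟩
  have : β i ≠ 0 := hi
  have := hd i
  positivity

lemma precForm_eq (hK : K.IsHermitian) (β : Fin n → ℝ) :
    precForm K d β = β ⬝ᵥ prec K d *ᵥ β := by
  rw [dotProduct_prec hK, precForm, sqnorm]
  congr 1
  exact Finset.sum_congr rfl fun i _ => by ring

lemma isUnit_prec (hK : K.IsHermitian) (hd : ∀ i, 0 < d i) : IsUnit (prec K d) := by
  rw [← mulVec_injective_iff_isUnit]
  change Function.Injective (prec K d).mulVecLin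
  refine (injective_iff_map_eq_zero (prec K d).mulVecLin).2 fun a h => ?_
  by_contra ha
  have := precForm_pos (K := K) hd ha
  rw [precForm_eq hK] at this
  have h' : prec K d *ᵥ a = 0 := h
  simp [h'] at this

lemma prec_mulVec_condMean (hK : K.IsHermitian) (hd : ∀ i, 0 < d i) (Y : Fin n → ℝ) :
    prec K d *ᵥ condMean K d Y = K *ᵥ Y := by
  rw [condMean, mulVec_mulVec, mul_nonsing_inv _ ((isUnit_iff_isUnit_det _).1 (isUnit_prec hK hd)),
    one_mulVec]

lemma fitQ_eq_precForm (hK : K.IsHermitian) (hd : ∀ i, 0 < d i) (Y : Fin n → ℝ) :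
    fitQ K d Y = precForm K d (condMean K d Y) := by
  rw [precForm_eq hK, prec_mulVec_condMean hK hd, fitQ, dotProduct_comm]

lemma complete_square (hK : K.IsHermitian) (hd : ∀ i, 0 < d i) (Y β : Fin n → ℝ) :
    sqnorm (Y - K *ᵥ β) + ∑ i, d i * β i ^ 2 =
      precForm K d (β - condMean K d Y) + (sqnorm Y - fitQ K d Y) := by
  set μ := condMean K d Y with hμ
  have h1 : fitQ K d Y = (K *ᵥ Y) ⬝ᵥ μ := rfl
  have h2 : β ⬝ᵥ prec K d *ᵥ μ = (K *ᵥ Y) ⬝ᵥ β := by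
    rw [hμ, prec_mulVec_condMean hK hd, dotProduct_comm]
  have h3 := fitQ_eq_precForm hK hd Y
  rw [← hμ] at h3
  have h4 : Y ⬝ᵥ K *ᵥ β = (K *ᵥ Y) ⬝ᵥ β := dotProduct_mulVec_of_symm hK _ _
  rw [dotProduct_prec hK] at h2
  have h5 : ∑ i, d i * (β - μ) i ^ 2 =
      ∑ i, d i * β i ^ 2 - 2 * ∑ i, d i * β i * μ i + ∑ i, d i * μ i ^ 2 := by
    rw [Finset.mul_sum, ← Finset.sum_sub_distrib, ← Finset.sum_add_distrib]
    exact Finset.sum_congr rfl fun i _ => by simp only [Pi.sub_apply]; ring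
  have h6 : sqnorm (K *ᵥ (β - μ)) =
      sqnorm (K *ᵥ β) - 2 * ((K *ᵥ β) ⬝ᵥ (K *ᵥ μ)) + sqnorm (K *ᵥ μ) := by
    rw [mulVec_sub, sqnorm_sub]
  rw [precForm] at h3 ⊢
  rw [sqnorm_sub, h4, h5, h6]
  linarith

lemma sqnorm_mulVec_condMean_le (hK : K.IsHermitian) (hd : ∀ i, 0 < d i) (Y : Fin n → ℝ) :
    sqnorm (K *ᵥ condMean K d Y) ≤ fitQ K d Y := by
  rw [fitQ_eq_precForm hK hd, precForm]
  exact le_add_of_nonneg_right (Finset.sum_nonneg fun i _ => mul_nonneg (hd i).le (sq_nonneg _))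

lemma fitQ_nonneg (hK : K.IsHermitian) (hd : ∀ i, 0 < d i) (Y : Fin n → ℝ) : 0 ≤ fitQ K d Y :=
  (sqnorm_nonneg _).trans (sqnorm_mulVec_condMean_le hK hd Y)

lemma residual_eq (hK : K.IsHermitian) (hd : ∀ i, 0 < d i) (Y : Fin n → ℝ) :
    sqnorm Y - fitQ K d Y = sqnorm (Y - K *ᵥ condMean K d Y) +
      ∑ i, d i * condMean K d Y i ^ 2 := by
  rw [complete_square hK hd]
  simp [precForm, sqnorm]

lemma fitQ_le (hK : K.IsHermitian) (hd : ∀ i, 0 < d i) (Y : Fin n → ℝ) :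
    fitQ K d Y ≤ sqnorm Y := by
  have h := residual_eq hK hd Y
  have h1 := sqnorm_nonneg (Y - K *ᵥ condMean K d Y)
  have h2 : 0 ≤ ∑ i, d i * condMean K d Y i ^ 2 :=
    Finset.sum_nonneg fun i _ => mul_nonneg (hd i).le (sq_nonneg _)
  linarith

lemma fitQ_lt (hK : K.IsHermitian) (hd : ∀ i, 0 < d i) {Y : Fin n → ℝ} (hY : Y ≠ 0) :
    fitQ K d Y < sqnorm Y := by
  rw [← sub_pos, residual_eq hK hd]
  by_cases h : condMean K d Y = 0
  · simpa [h] using sqnorm_pos hY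
  · obtain ⟨i, hi⟩ := Function.ne_iff.1 h
    refine add_pos_of_nonneg_of_pos (sqnorm_nonneg _) ?_
    refine Finset.sum_pos' (fun i _ => mul_nonneg (hd i).le (sq_nonneg _))
      ⟨i, Finset.mem_univ _, ?_⟩
    have : condMean K d Y i ≠ 0 := hi
    have := hd i
    positivity

lemma fitQ_smul (r : ℝ) (Y : Fin n → ℝ) : fitQ K d (r • Y) = r ^ 2 * fitQ K d Y := by
  simp only [fitQ, condMean, mulVec_smul, smul_dotProduct, dotProduct_smul, smul_eq_mul]; ring

/-- A separable bound on the explained quadratic form, split into signal and noise. -/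
lemma fitQ_add_le (hK : K.IsHermitian) (hd : ∀ i, 0 < d i) {c : ℝ}
    (hc : ∀ x, c ^ 2 * sqnorm x ≤ sqnorm (K *ᵥ x)) (θ ε : Fin n → ℝ) :
    fitQ K d (θ + ε) ≤ 2 * sqnorm θ + 2 * ∑ i, (K *ᵥ ε) i ^ 2 / (c ^ 2 + d i) := by
  set Y := θ + ε with hY
  set μ := condMean K d Y with hμ
  have h1 : fitQ K d Y = Y ⬝ᵥ K *ᵥ μ := by
    rw [dotProduct_mulVec_of_symm hK]; rfl
  have h2 : fitQ K d Y = sqnorm (K *ᵥ μ) + ∑ i, d i * μ i ^ 2 := by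
    rw [fitQ_eq_precForm hK hd]; rfl
  have h3 : Y ⬝ᵥ K *ᵥ μ = θ ⬝ᵥ K *ᵥ μ + (K *ᵥ ε) ⬝ᵥ μ := by
    rw [hY, add_dotProduct, dotProduct_mulVec_of_symm hK ε]
  have h4 : 2 * (θ ⬝ᵥ K *ᵥ μ) ≤ 2 * sqnorm θ + sqnorm (K *ᵥ μ) / 2 := by
    have := two_dotProduct_le ((2 : ℝ) • θ) (K *ᵥ μ)
    rw [sqnorm_smul, smul_dotProduct, smul_eq_mul] at this
    linarith
  have h5 := hc μ
  have h6 : 2 * ((K *ᵥ ε) ⬝ᵥ μ) - (c ^ 2 * sqnorm μ + ∑ i, d i * μ i ^ 2) / 2 ≤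
      2 * ∑ i, (K *ᵥ ε) i ^ 2 / (c ^ 2 + d i) := by
    rw [sqnorm_eq_sum, dotProduct, Finset.mul_sum, Finset.mul_sum, Finset.mul_sum,
      ← Finset.sum_add_distrib, Finset.sum_div, ← Finset.sum_sub_distrib]
    refine Finset.sum_le_sum fun i _ => ?_
    have hp : 0 < c ^ 2 + d i := add_pos_of_nonneg_of_pos (sq_nonneg c) (hd i)
    rw [mul_div_assoc', le_div_iff₀ hp]
    nlinarith [sq_nonneg ((c ^ 2 + d i) * μ i - 2 * (K *ᵥ ε) i)]
  have h7 : 0 ≤ ∑ i, d i * μ i ^ 2 :=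
    Finset.sum_nonneg fun i _ => mul_nonneg (hd i).le (sq_nonneg _)
  linarith

lemma continuous_sqnorm : Continuous (sqnorm : (Fin n → ℝ) → ℝ) := by
  unfold sqnorm; fun_prop

lemma measurable_condMean (K : Matrix (Fin n) (Fin n) ℝ) :
    Measurable fun z : (Fin n → ℝ) × (Fin n → ℝ) => condMean K z.1 z.2 := by
  have hP : Continuous fun z : (Fin n → ℝ) × (Fin n → ℝ) => prec K z.1 :=
    continuous_const.add (continuous_fst.matrix_diagonal)
  have h : (fun z : (Fin n → ℝ) × (Fin n → ℝ) => condMean K z.1 z.2) =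
      fun z => (prec K z.1).det⁻¹ • ((prec K z.1).adjugate *ᵥ (K *ᵥ z.2)) := by
    ext1 z
    rw [condMean, Matrix.inv_def, Ring.inverse_eq_inv', smul_mulVec]
  rw [h]
  refine Measurable.smul hP.matrix_det.measurable.inv ?_
  refine (Continuous.matrix_mulVec hP.matrix_adjugate ?_).measurable
  exact Continuous.matrix_mulVec continuous_const continuous_snd

lemma measurable_fitQ (K : Matrix (Fin n) (Fin n) ℝ) :
    Measurable fun z : (Fin n → ℝ) × (Fin n → ℝ) => fitQ K z.1 z.2 := by
  have h1 := measurable_condMean K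
  have h2 : Measurable fun z : (Fin n → ℝ) × (Fin n → ℝ) => K *ᵥ z.2 :=
    (Continuous.matrix_mulVec continuous_const continuous_snd).measurable
  unfold fitQ dotProduct
  exact Finset.measurable_sum _ fun i _ =>
    ((measurable_pi_apply i).comp h2).mul ((measurable_pi_apply i).comp h1)

lemma sqnorm_mulVec_ge {c : ℝ} (hc : 0 < c)
    (h : (K - c • (1 : Matrix (Fin n) (Fin n) ℝ)).PosSemidef) (x : Fin n → ℝ) :
    c ^ 2 * sqnorm x ≤ sqnorm (K *ᵥ x) := by
  have h1 := h.dotProduct_mulVec_nonneg x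
  simp only [star_trivial, sub_mulVec, smul_mulVec, one_mulVec, dotProduct_sub,
    dotProduct_smul, smul_eq_mul] at h1
  have h2 := two_dotProduct_le (c • x) (K *ᵥ x)
  rw [sqnorm_smul, smul_dotProduct, smul_eq_mul] at h2
  change 0 ≤ _ - c * sqnorm x at h1
  nlinarith

lemma sqnorm_mulVec_le (hK : K.PosDef) {c : ℝ} (hc : 0 < c)
    (h : (c • (1 : Matrix (Fin n) (Fin n) ℝ) - K).PosSemidef) (x : Fin n → ℝ) :
    sqnorm (K *ᵥ x) ≤ c ^ 2 * sqnorm x := by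
  have hform : ∀ y, y ⬝ᵥ K *ᵥ y ≤ c * sqnorm y := fun y => by
    have h1 := h.dotProduct_mulVec_nonneg y
    simp only [star_trivial, sub_mulVec, smul_mulVec, one_mulVec, dotProduct_sub,
      dotProduct_smul, smul_eq_mul] at h1
    exact sub_nonneg.1 h1
  set u := K *ᵥ x with hu
  have h0 := hK.posSemidef.dotProduct_mulVec_nonneg (c • x - u)
  have hxu : x ⬝ᵥ K *ᵥ u = sqnorm u := dotProduct_mulVec_of_symm hK.isHermitian x u
  simp only [star_trivial, mulVec_sub, mulVec_smul, sub_dotProduct, smul_dotProduct,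
    dotProduct_sub, dotProduct_smul, smul_eq_mul, ← hu, hxu] at h0
  have huu : u ⬝ᵥ u = sqnorm u := rfl
  rw [huu] at h0
  have h1 := hform x
  have h2 := hform u
  rw [← hu] at h1
  nlinarith

lemma sqnorm_row_le (hK : K.IsHermitian) {c : ℝ}
    (h : ∀ x, sqnorm (K *ᵥ x) ≤ c ^ 2 * sqnorm x) (i : Fin n) : sqnorm (K i) ≤ c ^ 2 := by
  have h1 := h (Pi.single i 1)
  have h2 : K *ᵥ Pi.single i 1 = K i := by
    ext j
    simpa using hK.apply i j
  simpa [h2, sqnorm] using h1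

end LinearAlgebra

attribute [irreducible] fitQ condMean

section LintegralTools

/-- Fubini for a product of one-variable functions under a product measure. -/
lemma lintegral_pi_prod {ν : Measure ℝ} [SigmaFinite ν] {n : ℕ} (h : Fin n → ℝ → ℝ≥0∞)
    (hm : ∀ i, AEMeasurable (h i) ν) :
    ∫⁻ x, ∏ i, h i (x i) ∂Measure.pi (fun _ : Fin n => ν) = ∏ i, ∫⁻ t, h i t ∂ν := by
  induction n with
  | zero => simp
  | succ n ih =>
    have e := (measurePreserving_piFinSuccAbove (fun _ : Fin (n + 1) => ν) 0).symm
    rw [← e.lintegral_comp_emb (MeasurableEquiv.measurableEmbedding _)]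
    simp only [Fin.prod_univ_succ, MeasurableEquiv.piFinSuccAbove_symm_apply,
      Fin.insertNthEquiv_zero, Fin.consEquiv_apply, Fin.cons_zero, Fin.cons_succ]
    have hpi : ∀ i : Fin n, AEMeasurable (fun x : Fin n → ℝ => h i.succ (x i))
        (Measure.pi fun _ : Fin n => ν) := fun i =>
      (hm i.succ).comp_quasiMeasurePreserving
        (Measure.quasiMeasurePreserving_eval (μ := fun _ : Fin n => ν) i)
    rw [lintegral_prod_mul (hm 0) (Finset.aemeasurable_fun_prod _ fun i _ => hpi i),
      ih _ fun i => hm i.succ]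

lemma lintegral_eq_scale {E : Type*} [NormedAddCommGroup E] [NormedSpace ℝ E]
    [MeasurableSpace E] [BorelSpace E] [FiniteDimensional ℝ E] (μ : Measure E)
    [μ.IsAddHaarMeasure] (f : E → ℝ≥0∞) {r : ℝ} (hr : 0 < r) :
    ∫⁻ x, f x ∂μ = ENNReal.ofReal (r ^ Module.finrank ℝ E) * ∫⁻ x, f (r • x) ∂μ := by
  have h1 : ∫⁻ x, f (r • x) ∂μ = ∫⁻ x, f x ∂(μ.map (r • ·)) :=
    ((measurableEmbedding_const_smul₀ hr.ne').lintegral_map f).symm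
  have hp : 0 < r ^ Module.finrank ℝ E := pow_pos hr _
  rw [h1, Measure.map_addHaar_smul μ hr.ne', lintegral_smul_measure, smul_eq_mul, ← mul_assoc,
    ← ENNReal.ofReal_mul hp.le, abs_of_pos (inv_pos.2 hp), mul_inv_cancel₀ hp.ne',
    ENNReal.ofReal_one, one_mul]

lemma lintegral_Ioi_eq_scale (f : ℝ → ℝ≥0∞) {r : ℝ} (hr : 0 < r) :
    ∫⁻ s in Set.Ioi (0 : ℝ), f s = ENNReal.ofReal r * ∫⁻ s in Set.Ioi (0 : ℝ), f (r * s) := by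
  rw [← lintegral_indicator measurableSet_Ioi, ← lintegral_indicator measurableSet_Ioi,
    lintegral_eq_scale volume _ hr]
  simp only [Module.finrank_self, pow_one]
  congr 1
  refine lintegral_congr fun s => ?_
  by_cases hs : 0 < s
  · rw [Set.indicator_of_mem (by simpa using mul_pos hr hs), Set.indicator_of_mem (by simpa)]; rfl
  · rw [Set.indicator_of_notMem (by simpa [mul_pos_iff_of_pos_left hr] using hs),
      Set.indicator_of_notMem (by simpa using hs)]

/-- The normalizing integral of the inverse-gamma law. -/
def invGammaMass (p : ℝ) : ℝ≥0∞ :=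
  ∫⁻ s in Set.Ioi (0 : ℝ), ENNReal.ofReal (s ^ (-p - 1) * Real.exp (-1 / (2 * s)))

lemma lintegral_invGamma (p : ℝ) {B : ℝ} (hB : 0 < B) :
    ∫⁻ s in Set.Ioi (0 : ℝ), ENNReal.ofReal (s ^ (-p - 1) * Real.exp (-B / (2 * s))) =
      ENNReal.ofReal (B ^ (-p)) * invGammaMass p := by
  rw [lintegral_Ioi_eq_scale _ hB, invGammaMass, ← lintegral_const_mul' _ _ ENNReal.ofReal_ne_top,
    ← lintegral_const_mul' _ _ ENNReal.ofReal_ne_top]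
  refine setLIntegral_congr_fun measurableSet_Ioi fun s hs => ?_
  have hs : 0 < s := hs
  rw [← ENNReal.ofReal_mul hB.le, ← ENNReal.ofReal_mul (by positivity),
    Real.mul_rpow hB.le hs.le, Real.rpow_sub_one hB.ne']
  congr 1
  rw [show -B / (2 * (B * s)) = -1 / (2 * s) by field_simp]
  field_simp

/-- The normalizing integral of the gamma law with rate `1 / 2`. -/
def gammaMass (p : ℝ) : ℝ≥0∞ :=
  ∫⁻ s in Set.Ioi (0 : ℝ), ENNReal.ofReal (s ^ (p - 1) * Real.exp (-s / 2))

lemma lintegral_gamma (p : ℝ) {B : ℝ} (hB : 0 < B) :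
    ∫⁻ s in Set.Ioi (0 : ℝ), ENNReal.ofReal (s ^ (p - 1) * Real.exp (-(s * B) / 2)) =
      ENNReal.ofReal (B ^ (-p)) * gammaMass p := by
  have hB' := inv_pos.2 hB
  rw [lintegral_Ioi_eq_scale _ hB', gammaMass, ← lintegral_const_mul' _ _ ENNReal.ofReal_ne_top,
    ← lintegral_const_mul' _ _ ENNReal.ofReal_ne_top]
  refine setLIntegral_congr_fun measurableSet_Ioi fun s hs => ?_
  have hs : 0 < s := hs
  rw [← ENNReal.ofReal_mul hB'.le, ← ENNReal.ofReal_mul (by positivity),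
    Real.mul_rpow hB'.le hs.le, Real.rpow_sub_one hB'.ne', Real.inv_rpow hB.le, Real.rpow_neg hB.le]
  congr 1
  rw [show -(B⁻¹ * s * B) / 2 = -s / 2 by field_simp]
  field_simp

lemma gammaMass_ne_top {p : ℝ} (hp : 0 < p) : gammaMass p ≠ ∞ := by
  have h := integrableOn_rpow_mul_exp_neg_mul_rpow (s := p - 1) (p := 1) (b := 1 / 2)
    (by linarith) (by norm_num) (by norm_num)
  have h2 := h.lintegral_lt_top
  refine ne_of_lt (lt_of_eq_of_lt ?_ h2)
  refine setLIntegral_congr_fun measurableSet_Ioi fun s _ => ?_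
  simp only [Real.rpow_one]
  congr 3; ring

lemma gammaMass_ne_zero (p : ℝ) : gammaMass p ≠ 0 := by
  unfold gammaMass
  refine (setLIntegral_pos_iff ?_).2 ?_ |>.ne'
  · fun_prop
  · refine lt_of_lt_of_le (b := volume (Set.Ioi (0 : ℝ))) (by simp) (measure_mono fun s hs => ?_)
    have hs' : 0 < s := hs
    refine ⟨?_, hs⟩
    simp only [Function.mem_support, ne_eq, ENNReal.ofReal_eq_zero, not_le]
    positivity

lemma lintegral_gaussian {a : ℝ} (ha : 0 < a) :
    ∫⁻ t : ℝ, ENNReal.ofReal (Real.exp (-(a * t ^ 2) / 2)) =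
      ENNReal.ofReal (√(2 * Real.pi / a)) := by
  have h1 := integral_gaussian (a / 2)
  have h2 := integrable_exp_neg_mul_sq (half_pos ha)
  rw [show 2 * Real.pi / a = Real.pi / (a / 2) by field_simp, ← h1,
    ofReal_integral_eq_lintegral_ofReal h2 (ae_of_all _ fun _ => (Real.exp_pos _).le)]
  refine lintegral_congr fun t => ?_
  congr 2; ring

lemma lintegral_gaussian_pi {n : ℕ} {a : Fin n → ℝ} (ha : ∀ i, 0 < a i) :
    ∫⁻ x : Fin n → ℝ, ENNReal.ofReal (Real.exp (-(∑ i, a i * x i ^ 2) / 2)) =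
      ∏ i, ENNReal.ofReal (√(2 * Real.pi / a i)) := by
  have h : ∀ x : Fin n → ℝ, ENNReal.ofReal (Real.exp (-(∑ i, a i * x i ^ 2) / 2)) =
      ∏ i, ENNReal.ofReal (Real.exp (-(a i * x i ^ 2) / 2)) := fun x => by
    rw [← ENNReal.ofReal_prod_of_nonneg fun _ _ => (Real.exp_pos _).le, ← Real.exp_sum,
      ← Finset.sum_div, Finset.sum_neg_distrib]
  simp only [h]
  have := lintegral_pi_prod (ν := volume)
    (fun i : Fin n => fun t : ℝ => ENNReal.ofReal (Real.exp (-(a i * t ^ 2) / 2)))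
    (fun i => by fun_prop)
  rw [← volume_pi] at this
  rw [this]
  exact Finset.prod_congr rfl fun i _ => lintegral_gaussian (ha i)

lemma lintegral_exp_neg_sqnorm (n : ℕ) {a : ℝ} (ha : 0 < a) :
    ∫⁻ x : Fin n → ℝ, ENNReal.ofReal (Real.exp (-(a * sqnorm x) / 2)) =
      ENNReal.ofReal ((2 * Real.pi / a) ^ ((n : ℝ) / 2)) := by
  have h := lintegral_gaussian_pi (n := n) (a := fun _ => a) fun _ => ha
  simp only [← Finset.mul_sum, ← sqnorm_eq_sum] at h
  rw [h, Finset.prod_const, Finset.card_univ, Fintype.card_fin, ← ENNReal.ofReal_pow (by positivity),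
    Real.sqrt_eq_rpow, ← Real.rpow_natCast, ← Real.rpow_mul (by positivity)]
  congr 2; ring

end LintegralTools

section Homogeneous

variable {n : ℕ} {N S : (Fin n → ℝ) → ℝ}

lemma nonneg_of_homogeneous (hN : ∀ r Y, N (r • Y) = r ^ 2 * N Y) (hpos : ∀ Y, Y ≠ 0 → 0 < N Y)
    (Y : Fin n → ℝ) : 0 ≤ N Y := by
  by_cases h : Y = 0
  · have := hN 0 0
    rw [h]; simp at this; exact this.ge
  · exact (hpos Y h).le

lemma mass_mul_lintegral_homogeneous (hn : n ≠ 0) (hNm : Measurable N) (hSm : Measurable S)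
    (hN : ∀ r Y, N (r • Y) = r ^ 2 * N Y) (hS : ∀ r Y, S (r • Y) = r ^ 2 * S Y)
    (hNpos : ∀ Y, Y ≠ 0 → 0 < N Y) (hSpos : ∀ Y, Y ≠ 0 → 0 < S Y) :
    invGammaMass (n / 2) *
        ∫⁻ Y, ENNReal.ofReal ((N Y / S Y) ^ ((n : ℝ) / 2) * Real.exp (-N Y / 2)) =
      gammaMass (n / 2) * ∫⁻ Y, ENNReal.ofReal (Real.exp (-S Y / 2)) := by
  have : NeZero n := ⟨hn⟩
  have hNn := nonneg_of_homogeneous hN hNpos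
  have hSn := nonneg_of_homogeneous hS hSpos
  set p : ℝ := (n : ℝ) / 2 with hp
  have hae : ∀ᵐ Y : Fin n → ℝ, Y ≠ 0 := by
    simp [ae_iff, measure_singleton]
  let F : ℝ → (Fin n → ℝ) → ℝ≥0∞ := fun s Y =>
    ENNReal.ofReal (N Y ^ p * Real.exp (-N Y / 2)) *
      ENNReal.ofReal (s ^ (-p - 1) * Real.exp (-S Y / (2 * s)))
  let G : ℝ → (Fin n → ℝ) → ℝ≥0∞ := fun s Y =>
    ENNReal.ofReal (N Y ^ p * Real.exp (-S Y / 2)) *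
      ENNReal.ofReal (s ^ (p - 1) * Real.exp (-(s * N Y) / 2))
  have hF : Measurable (Function.uncurry F) := by unfold F Function.uncurry; fun_prop
  have hG : Measurable (Function.uncurry G) := by unfold G Function.uncurry; fun_prop
  have h1 : invGammaMass p * ∫⁻ Y, ENNReal.ofReal ((N Y / S Y) ^ p * Real.exp (-N Y / 2)) =
      ∫⁻ Y, ∫⁻ s in Set.Ioi (0 : ℝ), F s Y := by
    rw [← lintegral_const_mul _ (by fun_prop)]
    refine lintegral_congr_ae ?_
    filter_upwards [hae] with Y hY
    rw [lintegral_const_mul' _ _ ENNReal.ofReal_ne_top, lintegral_invGamma _ (hSpos Y hY),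
      ← mul_assoc, ← ENNReal.ofReal_mul (by positivity [hNn Y]), mul_comm]
    congr 2
    rw [Real.div_rpow (hNn Y) (hSn Y), Real.rpow_neg (hSn Y)]
    ring
  have h2 : gammaMass p * ∫⁻ Y, ENNReal.ofReal (Real.exp (-S Y / 2)) =
      ∫⁻ Y, ∫⁻ s in Set.Ioi (0 : ℝ), G s Y := by
    rw [← lintegral_const_mul _ (by fun_prop)]
    refine lintegral_congr_ae ?_
    filter_upwards [hae] with Y hY
    have := hNpos Y hY
    rw [lintegral_const_mul' _ _ ENNReal.ofReal_ne_top, lintegral_gamma _ this,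
      ← mul_assoc, ← ENNReal.ofReal_mul (by positivity), mul_comm]
    congr 2
    rw [Real.rpow_neg this.le]
    field_simp
  rw [h1, h2, lintegral_lintegral_swap (f := fun Y s => F s Y) (hF.comp measurable_swap).aemeasurable,
    lintegral_lintegral_swap (f := fun Y s => G s Y) (hG.comp measurable_swap).aemeasurable]
  · refine setLIntegral_congr_fun measurableSet_Ioi fun s hs => ?_
    have hs : 0 < s := hs
    rw [lintegral_eq_scale volume _ (Real.sqrt_pos.2 hs),
      ← lintegral_const_mul' _ _ ENNReal.ofReal_ne_top]
    refine lintegral_congr fun Y => ?_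
    have hNY := hNn Y
    have e1 : √s ^ Module.finrank ℝ (Fin n → ℝ) = s ^ p := by
      rw [Module.finrank_fintype_fun_eq_card, Fintype.card_fin, Real.sqrt_eq_rpow,
        ← Real.rpow_natCast, ← Real.rpow_mul hs.le, hp]
      congr 1; ring
    simp only [F, G, hN, hS, Real.sq_sqrt hs.le, e1]
    rw [← ENNReal.ofReal_mul (by positivity), ← ENNReal.ofReal_mul (by positivity),
      ← ENNReal.ofReal_mul (by positivity), Real.mul_rpow hs.le hNY,
      show -(s * S Y) / (2 * s) = -S Y / 2 by field_simp]
    congr 1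
    have e2 : s ^ p * s ^ p * s ^ (-p - 1) = s ^ (p - 1) := by
      rw [← Real.rpow_add hs, ← Real.rpow_add hs]; congr 1; ring
    rw [← e2]; ring

lemma invGammaMass_eq_gammaMass (hn : n ≠ 0) :
    invGammaMass ((n : ℝ) / 2) = gammaMass (n / 2) := by
  have hh : ∀ (r : ℝ) (Y : Fin n → ℝ), sqnorm (r • Y) = r ^ 2 * sqnorm Y := sqnorm_smul
  have hp : ∀ Y : Fin n → ℝ, Y ≠ 0 → 0 < sqnorm Y := fun _ => sqnorm_pos
  have hm := (continuous_sqnorm (n := n)).measurable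
  have h := mass_mul_lintegral_homogeneous hn hm hm hh hh hp hp
  have : NeZero n := ⟨hn⟩
  have hI := lintegral_exp_neg_sqnorm n one_pos
  have h1 : ∫⁻ Y : Fin n → ℝ, ENNReal.ofReal
      ((sqnorm Y / sqnorm Y) ^ ((n : ℝ) / 2) * Real.exp (-sqnorm Y / 2)) =
      ∫⁻ Y : Fin n → ℝ, ENNReal.ofReal (Real.exp (-(1 * sqnorm Y) / 2)) := by
    refine lintegral_congr_ae ?_
    have hae : ∀ᵐ Y : Fin n → ℝ, Y ≠ 0 := by
      simp [ae_iff, measure_singleton]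
    filter_upwards [hae] with Y hY
    rw [div_self (sqnorm_pos hY).ne', Real.one_rpow]
    simp
  rw [h1] at h
  simp only [one_mul] at h hI
  rw [hI] at h
  refine (ENNReal.mul_left_inj ?_ ENNReal.ofReal_ne_top).1 h
  simp only [ne_eq, ENNReal.ofReal_eq_zero, not_le]
  positivity

/-- For quadratic-type functions, integrating the `n / 2`-th power of a ratio against the
Gaussian weight of the numerator gives the Gaussian integral of the denominator. -/
lemma lintegral_ratio_rpow (hn : n ≠ 0) (hNm : Measurable N) (hSm : Measurable S)
    (hN : ∀ r Y, N (r • Y) = r ^ 2 * N Y) (hS : ∀ r Y, S (r • Y) = r ^ 2 * S Y)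
    (hNpos : ∀ Y, Y ≠ 0 → 0 < N Y) (hSpos : ∀ Y, Y ≠ 0 → 0 < S Y) :
    ∫⁻ Y, ENNReal.ofReal ((N Y / S Y) ^ ((n : ℝ) / 2) * Real.exp (-N Y / 2)) =
      ∫⁻ Y, ENNReal.ofReal (Real.exp (-S Y / 2)) := by
  have h := mass_mul_lintegral_homogeneous hn hNm hSm hN hS hNpos hSpos
  rw [invGammaMass_eq_gammaMass hn] at h
  refine (ENNReal.mul_right_inj (gammaMass_ne_zero _) (gammaMass_ne_top ?_)).1 h
  have : 0 < n := Nat.pos_of_ne_zero hn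
  positivity

end Homogeneous

section GaussianForms

variable {n : ℕ}

lemma lintegral_exp_shift (x : ℝ) :
    ∫⁻ ξ : ℝ, ENNReal.ofReal (Real.exp (-ξ ^ 2 + 2 * ξ * x)) =
      ENNReal.ofReal (√Real.pi * Real.exp (x ^ 2)) := by
  have h := lintegral_gaussian two_pos
  rw [← lintegral_sub_right_eq_self _ x] at h
  rw [mul_div_cancel_left₀ _ two_ne_zero] at h
  rw [mul_comm, ENNReal.ofReal_mul (Real.exp_pos _).le, ← h,
    ← lintegral_const_mul' _ _ ENNReal.ofReal_ne_top]
  refine lintegral_congr fun ξ => ?_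
  rw [← ENNReal.ofReal_mul (Real.exp_pos _).le, ← Real.exp_add]
  congr 2; ring

/-- Exponential moment of the square of a Gaussian linear form. -/
lemma lintegral_exp_sq_dotProduct_le {σ2 α : ℝ} (hσ : 0 < σ2) (hα : 0 ≤ α) (k : Fin n → ℝ)
    (hk : 2 * α * σ2 * sqnorm k ≤ 1 / 2) :
    ∫⁻ ε, ENNReal.ofReal (Real.exp (α * (k ⬝ᵥ ε) ^ 2) * Real.exp (-sqnorm ε / (2 * σ2))) ≤
      ENNReal.ofReal (√2 * (2 * Real.pi * σ2) ^ ((n : ℝ) / 2)) := by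
  have hpi := Real.pi_pos
  have hspi : 0 < √Real.pi := Real.sqrt_pos.2 hpi
  let F : (Fin n → ℝ) → ℝ → ℝ≥0∞ := fun ε ξ =>
    ENNReal.ofReal (Real.exp (-sqnorm ε / (2 * σ2))) *
      ENNReal.ofReal (Real.exp (-ξ ^ 2 + 2 * ξ * (√α * (k ⬝ᵥ ε))))
  have hsm : Measurable (sqnorm : (Fin n → ℝ) → ℝ) := continuous_sqnorm.measurable
  have hdm : Measurable fun ε : Fin n → ℝ => k ⬝ᵥ ε := by unfold dotProduct; fun_prop
  have hF : Measurable (Function.uncurry F) := by unfold F Function.uncurry; fun_prop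
  have h1 : ENNReal.ofReal (√Real.pi) * ∫⁻ ε, ENNReal.ofReal
      (Real.exp (α * (k ⬝ᵥ ε) ^ 2) * Real.exp (-sqnorm ε / (2 * σ2))) = ∫⁻ ε, ∫⁻ ξ, F ε ξ := by
    rw [← lintegral_const_mul' _ _ ENNReal.ofReal_ne_top]
    refine lintegral_congr fun ε => ?_
    rw [lintegral_const_mul' _ _ ENNReal.ofReal_ne_top, lintegral_exp_shift,
      ← ENNReal.ofReal_mul (by positivity), ← ENNReal.ofReal_mul (by positivity), mul_pow,
      Real.sq_sqrt hα]
    congr 1; ring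
  have h2 : ∫⁻ ε, ∫⁻ ξ, F ε ξ ≤
      ENNReal.ofReal (√Real.pi) * ENNReal.ofReal (√2 * (2 * Real.pi * σ2) ^ ((n : ℝ) / 2)) := by
    rw [lintegral_lintegral_swap hF.aemeasurable]
    have h3 : ∀ ξ, ∫⁻ ε, F ε ξ ≤ ENNReal.ofReal ((2 * Real.pi * σ2) ^ ((n : ℝ) / 2)) *
        ENNReal.ofReal (Real.exp (-(1 * ξ ^ 2) / 2)) := fun ξ => by
      have hg := lintegral_exp_neg_sqnorm n (inv_pos.2 hσ)
      rw [div_inv_eq_mul, ← lintegral_sub_right_eq_self _ ((2 * √α * ξ * σ2) • k)] at hg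
      rw [← hg, ← lintegral_mul_const' _ _ ENNReal.ofReal_ne_top]
      refine lintegral_mono fun ε => ?_
      simp only [F]
      rw [← ENNReal.ofReal_mul (Real.exp_pos _).le, ← ENNReal.ofReal_mul (Real.exp_pos _).le,
        ← Real.exp_add, ← Real.exp_add]
      refine ENNReal.ofReal_le_ofReal (Real.exp_le_exp.2 ?_)
      rw [sqnorm_sub, sqnorm_smul, dotProduct_smul, smul_eq_mul, dotProduct_comm ε k]
      have e1 : (2 * √α * ξ * σ2) ^ 2 = 4 * α * ξ ^ 2 * σ2 ^ 2 := by
        rw [mul_pow, mul_pow, mul_pow, Real.sq_sqrt hα]; ring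
      rw [e1]
      have e2 : -(σ2⁻¹ * (sqnorm ε - 2 * (2 * √α * ξ * σ2 * (k ⬝ᵥ ε)) +
          4 * α * ξ ^ 2 * σ2 ^ 2 * sqnorm k)) / 2 =
          -sqnorm ε / (2 * σ2) + 2 * ξ * (√α * (k ⬝ᵥ ε)) - 2 * α * σ2 * sqnorm k * ξ ^ 2 := by
        field_simp; ring
      rw [e2]
      nlinarith [mul_le_mul_of_nonneg_right hk (sq_nonneg ξ)]
    refine (lintegral_mono h3).trans ?_
    rw [lintegral_const_mul' _ _ ENNReal.ofReal_ne_top, lintegral_gaussian one_pos,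
      ← ENNReal.ofReal_mul (by positivity), ← ENNReal.ofReal_mul (by positivity), div_one,
      Real.sqrt_mul two_pos.le]
    exact ENNReal.ofReal_le_ofReal (le_of_eq (by ring))
  rw [← h1] at h2
  exact (ENNReal.mul_le_mul_iff_right (by simpa using hspi) ENNReal.ofReal_ne_top).1 h2

variable {K : Matrix (Fin n) (Fin n) ℝ} {d : Fin n → ℝ}

lemma lintegral_exp_joint (hK : K.IsHermitian) (hd : ∀ i, 0 < d i) (Y : Fin n → ℝ) :
    ∫⁻ β, ENNReal.ofReal (Real.exp (-(sqnorm (Y - K *ᵥ β) + ∑ i, d i * β i ^ 2) / 2)) =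
      ENNReal.ofReal (Real.exp (-(sqnorm Y - fitQ K d Y) / 2)) *
        ∫⁻ β, ENNReal.ofReal (Real.exp (-precForm K d β / 2)) := by
  rw [← lintegral_sub_right_eq_self (fun β => ENNReal.ofReal (Real.exp (-precForm K d β / 2)))
      (condMean K d Y), ← lintegral_const_mul' _ _ ENNReal.ofReal_ne_top]
  refine lintegral_congr fun β => ?_
  rw [← ENNReal.ofReal_mul (Real.exp_pos _).le, ← Real.exp_add, complete_square hK hd]
  congr 2; ring

lemma lintegral_precForm_mul (hK : K.IsHermitian) (hd : ∀ i, 0 < d i) :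
    (∫⁻ β, ENNReal.ofReal (Real.exp (-precForm K d β / 2))) *
        ∫⁻ Y, ENNReal.ofReal (Real.exp (-(sqnorm Y - fitQ K d Y) / 2)) =
      ENNReal.ofReal ((2 * Real.pi) ^ ((n : ℝ) / 2)) * ∏ i, ENNReal.ofReal (√(2 * Real.pi / d i)) := by
  have hsm : Measurable (sqnorm : (Fin n → ℝ) → ℝ) := continuous_sqnorm.measurable
  have hKm : Measurable fun β => K *ᵥ β :=
    (Continuous.matrix_mulVec continuous_const continuous_id).measurable
  have hQ : Measurable (fitQ K d) := (measurable_fitQ K).comp (measurable_const.prodMk measurable_id)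
  let F : (Fin n → ℝ) → (Fin n → ℝ) → ℝ≥0∞ := fun Y β =>
    ENNReal.ofReal (Real.exp (-(sqnorm (Y - K *ᵥ β) + ∑ i, d i * β i ^ 2) / 2))
  have hF : Measurable (Function.uncurry F) := by
    unfold F Function.uncurry
    refine ENNReal.measurable_ofReal.comp (Real.measurable_exp.comp ?_)
    refine ((((hsm.comp (measurable_fst.sub (hKm.comp measurable_snd)))).add ?_).neg).div_const _
    fun_prop
  have h1 : ∫⁻ Y, ∫⁻ β, F Y β = (∫⁻ β, ENNReal.ofReal (Real.exp (-precForm K d β / 2))) *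
        ∫⁻ Y, ENNReal.ofReal (Real.exp (-(sqnorm Y - fitQ K d Y) / 2)) := by
    simp only [F, lintegral_exp_joint hK hd]
    rw [lintegral_mul_const _ (by fun_prop), mul_comm]
  rw [← h1, lintegral_lintegral_swap hF.aemeasurable, ← lintegral_gaussian_pi hd,
    ← lintegral_const_mul' _ _ ENNReal.ofReal_ne_top]
  refine lintegral_congr fun β => ?_
  have hg := lintegral_exp_neg_sqnorm n one_pos
  rw [div_one, ← lintegral_sub_right_eq_self _ (K *ᵥ β)] at hg
  rw [← hg, ← lintegral_mul_const' _ _ ENNReal.ofReal_ne_top]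
  refine lintegral_congr fun Y => ?_
  simp only [F]
  rw [← ENNReal.ofReal_mul (Real.exp_pos _).le, ← Real.exp_add]
  congr 2; ring

/-- The marginal likelihood factor `|Λ²|^{-1/2} ∫ exp(-βᵀ(K² + t⁻¹Λ⁻²)β / 2) dβ`. -/
def marg (K : Matrix (Fin n) (Fin n) ℝ) (t : ℝ) (l : Fin n → ℝ) : ℝ≥0∞ :=
  ENNReal.ofReal ((∏ i, l i) ^ (-(1 : ℝ) / 2)) *
    ∫⁻ β, ENNReal.ofReal (Real.exp (-precForm K (fun i => t⁻¹ / l i) β / 2))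

variable {t : ℝ} {l : Fin n → ℝ}

lemma ofReal_prod_rpow_mul_prod (hl : ∀ i, 0 < l i) (f : Fin n → ℝ) :
    ENNReal.ofReal ((∏ i, l i) ^ (-(1 : ℝ) / 2)) * ∏ i, ENNReal.ofReal (√(f i)) =
      ∏ i, ENNReal.ofReal (√(f i / l i)) := by
  rw [← Real.finsetProd_rpow _ _ fun i _ => (hl i).le,
    ENNReal.ofReal_prod_of_nonneg fun i _ => Real.rpow_nonneg (hl i).le _,
    ← Finset.prod_mul_distrib]
  refine Finset.prod_congr rfl fun i _ => ?_
  rw [← ENNReal.ofReal_mul (Real.rpow_nonneg (hl i).le _), Real.sqrt_div' _ (hl i).le, neg_div,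
    Real.rpow_neg (hl i).le, ← Real.sqrt_eq_rpow, div_eq_inv_mul]

lemma ofReal_sqrt_pow {x : ℝ} (hx : 0 ≤ x) :
    ENNReal.ofReal (√x) ^ n = ENNReal.ofReal (x ^ ((n : ℝ) / 2)) := by
  rw [← ENNReal.ofReal_pow (by positivity), Real.sqrt_eq_rpow, ← Real.rpow_natCast,
    ← Real.rpow_mul hx]
  congr 2; ring

/-- The marginal likelihood is normalized: the scale-free posterior ratio integrates to the
prior constant under the reference Gaussian law. -/
lemma marg_mul_lintegral (hn : n ≠ 0) (hK : K.IsHermitian) (ht : 0 < t) (hl : ∀ i, 0 < l i)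
    {σ2 : ℝ} (hσ : 0 < σ2) :
    marg K t l * ∫⁻ Y, ENNReal.ofReal
        ((sqnorm Y / (sqnorm Y - fitQ K (fun i => t⁻¹ / l i) Y)) ^ ((n : ℝ) / 2) *
          ((2 * Real.pi * σ2) ^ (-(n : ℝ) / 2) * Real.exp (-sqnorm Y / (2 * σ2)))) =
      ENNReal.ofReal ((2 * Real.pi * t) ^ ((n : ℝ) / 2)) := by
  have hd : ∀ i, 0 < t⁻¹ / l i := fun i => div_pos (inv_pos.2 ht) (hl i)
  set d : Fin n → ℝ := fun i => t⁻¹ / l i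
  have hpi := Real.pi_pos
  have hsm : Measurable (sqnorm : (Fin n → ℝ) → ℝ) := continuous_sqnorm.measurable
  have hQ : Measurable (fitQ K d) := (measurable_fitQ K).comp (measurable_const.prodMk measurable_id)
  have h := lintegral_ratio_rpow (N := fun Y => sqnorm Y / σ2) (S := fun Y => sqnorm Y - fitQ K d Y)
    hn (by fun_prop) (by fun_prop) (fun r Y => by simp only [sqnorm_smul]; ring)
    (fun r Y => by simp only [sqnorm_smul, fitQ_smul]; ring)
    (fun Y hY => div_pos (sqnorm_pos hY) hσ) (fun Y hY => sub_pos.2 (fitQ_lt hK hd hY))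
  have h1 : ∫⁻ Y, ENNReal.ofReal ((sqnorm Y / (sqnorm Y - fitQ K d Y)) ^ ((n : ℝ) / 2) *
          ((2 * Real.pi * σ2) ^ (-(n : ℝ) / 2) * Real.exp (-sqnorm Y / (2 * σ2)))) =
      ENNReal.ofReal ((2 * Real.pi) ^ (-(n : ℝ) / 2)) *
        ∫⁻ Y, ENNReal.ofReal (Real.exp (-(sqnorm Y - fitQ K d Y) / 2)) := by
    rw [← h, ← lintegral_const_mul' _ _ ENNReal.ofReal_ne_top]
    refine lintegral_congr fun Y => ?_
    have hS : 0 ≤ sqnorm Y - fitQ K d Y := sub_nonneg.2 (fitQ_le hK hd Y)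
    rw [← ENNReal.ofReal_mul (by positivity)]
    congr 1
    rw [show sqnorm Y / σ2 / (sqnorm Y - fitQ K d Y) =
        σ2⁻¹ * (sqnorm Y / (sqnorm Y - fitQ K d Y)) by ring,
      Real.mul_rpow (x := σ2⁻¹) (inv_nonneg.2 hσ.le) (div_nonneg (sqnorm_nonneg _) hS), neg_div,
      Real.mul_rpow (by positivity) hσ.le, Real.rpow_neg hσ.le, Real.inv_rpow hσ.le,
      show -sqnorm Y / (2 * σ2) = -(sqnorm Y / σ2) / 2 by ring]
    ring
  rw [h1, marg, mul_mul_mul_comm, lintegral_precForm_mul hK hd, mul_assoc, ← mul_assoc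
    (ENNReal.ofReal ((2 * Real.pi) ^ (-(n : ℝ) / 2))), ← ENNReal.ofReal_mul (by positivity),
    ← Real.rpow_add (by positivity), show -(n : ℝ) / 2 + n / 2 = 0 by ring, Real.rpow_zero,
    ENNReal.ofReal_one, one_mul, ofReal_prod_rpow_mul_prod hl, ← ofReal_sqrt_pow (by positivity)]
  have : ∀ i, 2 * Real.pi / (t⁻¹ / l i) / l i = 2 * Real.pi * t := fun i => by
    have := hl i
    field_simp
  simp [this]

lemma marg_ge (ht : 0 < t) (hl : ∀ i, 0 < l i) {c : ℝ}
    (hc : ∀ x, sqnorm (K *ᵥ x) ≤ c ^ 2 * sqnorm x) :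
    ENNReal.ofReal ((2 * Real.pi * t) ^ ((n : ℝ) / 2) *
      Real.exp (-(c ^ 2 * t / 2) * ∑ i, l i)) ≤ marg K t l := by
  have hpi := Real.pi_pos
  have hd : ∀ i, 0 < c ^ 2 + t⁻¹ / l i := fun i =>
    add_pos_of_nonneg_of_pos (sq_nonneg c) (div_pos (inv_pos.2 ht) (hl i))
  have h1 := lintegral_gaussian_pi hd
  have h2 : ∏ i, ENNReal.ofReal (√(2 * Real.pi / (c ^ 2 + t⁻¹ / l i))) ≤
      ∫⁻ β, ENNReal.ofReal (Real.exp (-precForm K (fun i => t⁻¹ / l i) β / 2)) := by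
    rw [← h1]
    refine lintegral_mono fun β => ENNReal.ofReal_le_ofReal (Real.exp_le_exp.2 ?_)
    have := hc β
    simp only [precForm, add_mul, Finset.sum_add_distrib, ← Finset.mul_sum, ← sqnorm_eq_sum]
    linarith
  refine le_trans ?_ (mul_le_mul_right h2 _)
  rw [ofReal_prod_rpow_mul_prod hl, ENNReal.ofReal_mul (by positivity),
    ← ofReal_sqrt_pow (by positivity), Finset.mul_sum, Real.exp_sum,
    ENNReal.ofReal_prod_of_nonneg (fun _ _ => (Real.exp_pos _).le)]
  have : ENNReal.ofReal (√(2 * Real.pi * t)) ^ n =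
    ∏ _i : Fin n, ENNReal.ofReal (√(2 * Real.pi * t)) := by simp
  rw [this, ← Finset.prod_mul_distrib]
  refine Finset.prod_le_prod' fun i _ => ?_
  rw [← ENNReal.ofReal_mul (Real.sqrt_nonneg _)]
  refine ENNReal.ofReal_le_ofReal (Real.le_sqrt_of_sq_le ?_)
  have hli := hl i
  have e1 : 2 * Real.pi / (c ^ 2 + t⁻¹ / l i) / l i = 2 * Real.pi * t / (1 + c ^ 2 * t * l i) := by
    field_simp; ring
  have e2 : Real.exp (-(c ^ 2 * t / 2) * l i) ^ 2 = (Real.exp (c ^ 2 * t * l i))⁻¹ := by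
    rw [← Real.exp_neg, ← Real.exp_nat_mul]; congr 1; push_cast; ring
  have hx : 0 ≤ c ^ 2 * t * l i := by positivity
  rw [mul_pow, Real.sq_sqrt (by positivity), e1, e2, div_eq_mul_inv]
  gcongr
  linarith [Real.add_one_le_exp (c ^ 2 * t * l i)]

end GaussianForms



/-- Lebesgue measure on the positive orthant. -/
def posPi (n : ℕ) : Measure (Fin n → ℝ) :=
  Measure.pi fun _ => volume.restrict (Set.Ioi (0 : ℝ))

lemma posPi_eq (n : ℕ) :
    posPi n = volume.restrict (Set.univ.pi fun _ : Fin n => Set.Ioi (0 : ℝ)) := by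
  rw [posPi, volume_pi, Measure.restrict_pi_pi]

instance (n : ℕ) : SFinite (posPi n) := by unfold posPi; infer_instance

lemma ae_posPi (n : ℕ) : ∀ᵐ l ∂posPi n, ∀ i, 0 < l i := by
  rw [posPi_eq]
  filter_upwards [ae_restrict_mem (MeasurableSet.univ_pi fun _ => measurableSet_Ioi)] with l hl i
  exact hl i (Set.mem_univ i)

lemma integrable_mul_of_bound {α : Type*} [MeasurableSpace α] {μ : Measure α} {J g : α → ℝ}
    {c : ℝ} (hJ : Integrable J μ) (hg : Measurable g) (hb : ∀ᵐ x ∂μ, |g x| ≤ c) :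
    Integrable (fun x => J x * g x) μ :=
  hJ.mul_bdd hg.aestronglyMeasurable hb

lemma integrable_mul_clm {α : Type*} [MeasurableSpace α] {μ : Measure α} {n : ℕ} {J : α → ℝ}
    {B : α → Fin n → ℝ} (hi : Integrable (fun p => J p • B p) μ) (L : (Fin n → ℝ) →L[ℝ] ℝ) :
    Integrable (fun p => J p * L (B p)) μ ∧ ∫ p, J p * L (B p) ∂μ = L (∫ p, J p • B p ∂μ) := by
  have h : ∀ p, L (J p • B p) = J p * L (B p) := fun p => by rw [map_smul, smul_eq_mul]
  have h1 := L.integrable_comp hi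
  have h2 := L.integral_comp_comm hi
  simp only [h] at h1 h2
  exact ⟨h1, h2⟩

namespace Model

variable (M : Model) {n : ℕ}

lemma restrict_posSet (n : ℕ) : (volume : Measure ((Fin n → ℝ) × ℝ × (Fin n → ℝ))).restrict
    (posSet n) = volume.prod ((volume.restrict (Set.Ioi (0 : ℝ))).prod (posPi n)) := by
  have h : posSet n = Set.univ ×ˢ (Set.Ioi (0 : ℝ) ×ˢ Set.univ.pi fun _ => Set.Ioi (0 : ℝ)) := by
    ext p; simp [posSet]
  rw [h, Measure.volume_eq_prod, ← Measure.prod_restrict, Measure.restrict_univ,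
    Measure.volume_eq_prod, ← Measure.prod_restrict, posPi_eq]

lemma measurableSet_posSet (n : ℕ) : MeasurableSet (posSet n) := by
  have h : posSet n = Set.univ ×ˢ (Set.Ioi (0 : ℝ) ×ˢ Set.univ.pi fun _ => Set.Ioi (0 : ℝ)) := by
    ext p; simp [posSet]
  rw [h]
  exact MeasurableSet.univ.prod (measurableSet_Ioi.prod
    (MeasurableSet.univ_pi fun _ => measurableSet_Ioi))

/-- The prior precisions `(τ² λᵢ²)⁻¹`. -/
def dvec (n : ℕ) (l : Fin n → ℝ) (i : Fin n) : ℝ := (M.τsq n)⁻¹ / l i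

lemma measurable_dvec (n : ℕ) : Measurable (M.dvec n) := by
  refine measurable_pi_lambda _ fun i => ?_
  unfold dvec; fun_prop

variable {M} in
lemma dvec_pos (ht : 0 < M.τsq n) {l : Fin n → ℝ} (hl : ∀ i, 0 < l i) (i : Fin n) :
    0 < M.dvec n l i := div_pos (inv_pos.2 ht) (hl i)

/-- The explained quadratic form given the local parameters. -/
def expl (n : ℕ) (Y l : Fin n → ℝ) : ℝ := fitQ (M.K n) (M.dvec n l) Y

/-- The scale of the conditional inverse-gamma law of `σ²`. -/
def resid (n : ℕ) (Y l : Fin n → ℝ) : ℝ := M.b + (sqnorm Y - M.expl n Y l)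

lemma measurable_expl (n : ℕ) :
    Measurable fun z : (Fin n → ℝ) × (Fin n → ℝ) => M.expl n z.1 z.2 :=
  (measurable_fitQ (M.K n)).comp (((M.measurable_dvec n).comp measurable_snd).prodMk measurable_fst)

lemma measurable_expl_right (n : ℕ) (Y : Fin n → ℝ) : Measurable (M.expl n Y) :=
  (M.measurable_expl n).comp (measurable_const.prodMk measurable_id)

variable {M} in
lemma expl_nonneg (ht : 0 < M.τsq n) (Y : Fin n → ℝ) {l : Fin n → ℝ} (hl : ∀ i, 0 < l i) :
    0 ≤ M.expl n Y l := fitQ_nonneg (M.hK n).isHermitian (dvec_pos ht hl) Y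

variable {M} in
lemma expl_le (ht : 0 < M.τsq n) (Y : Fin n → ℝ) {l : Fin n → ℝ} (hl : ∀ i, 0 < l i) :
    M.expl n Y l ≤ sqnorm Y := fitQ_le (M.hK n).isHermitian (dvec_pos ht hl) Y

variable {M} in
lemma jd_eq (ht : 0 < M.τsq n) (Y β : Fin n → ℝ) (s : ℝ) {l : Fin n → ℝ} (hl : ∀ i, 0 < l i) :
    M.jd n Y β s l = s ^ (-(n : ℝ) - M.a / 2 - 1) * (∏ i, M.pr (l i)) *
      (∏ i, l i) ^ (-(1 : ℝ) / 2) * Real.exp (-(precForm (M.K n) (M.dvec n l)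
        (β - condMean (M.K n) (M.dvec n l) Y) + M.resid n Y l) / (2 * s)) := by
  have h := complete_square (M.hK n).isHermitian (dvec_pos ht hl) Y β
  have h2 : ∑ i, M.dvec n l i * β i ^ 2 = (M.τsq n)⁻¹ * ∑ i, β i ^ 2 / l i := by
    rw [Finset.mul_sum]
    exact Finset.sum_congr rfl fun i _ => by simp only [dvec]; ring
  rw [jd, resid, expl]
  congr 3
  linarith

lemma jd_nonneg (Y β : Fin n → ℝ) {s : ℝ} (hs : 0 < s) {l : Fin n → ℝ} (hl : ∀ i, 0 < l i) :
    0 ≤ M.jd n Y β s l := by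
  have h1 : 0 ≤ ∏ i, M.pr (l i) := Finset.prod_nonneg fun i _ => M.hpr_nonneg _
  have h2 : 0 ≤ ∏ i, l i := Finset.prod_nonneg fun i _ => (hl i).le
  unfold jd; positivity

lemma ae_posSet (n : ℕ) : ∀ᵐ p ∂(volume : Measure ((Fin n → ℝ) × ℝ × (Fin n → ℝ))).restrict
    (posSet n), 0 < p.2.1 ∧ ∀ i, 0 < p.2.2 i :=
  ae_restrict_mem (measurableSet_posSet n)

/-- The posterior mean of `β` given the local parameters. -/
def cmean (n : ℕ) (Y l : Fin n → ℝ) : Fin n → ℝ := condMean (M.K n) (M.dvec n l) Y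

lemma measurable_cmean (n : ℕ) (Y : Fin n → ℝ) : Measurable (M.cmean n Y) := by
  have h : Measurable fun l => ((M.dvec n l, Y) : (Fin n → ℝ) × (Fin n → ℝ)) :=
    (M.measurable_dvec n).prodMk measurable_const
  exact (measurable_condMean (M.K n)).comp h

/-- The integrand weighted by a function odd about the conditional mean integrates to zero. -/
lemma integral_jd_odd (ht : 0 < M.τsq n) (Y : Fin n → ℝ) (v : Fin n → ℝ)
    (hint : IntegrableOn (fun p => M.jd n Y p.1 p.2.1 p.2.2 *
      (v ⬝ᵥ M.K n *ᵥ (p.1 - M.cmean n Y p.2.2))) (posSet n)) :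
    ∫ p in posSet n, M.jd n Y p.1 p.2.1 p.2.2 *
      (v ⬝ᵥ M.K n *ᵥ (p.1 - M.cmean n Y p.2.2)) = 0 := by
  rw [IntegrableOn, restrict_posSet] at hint
  rw [restrict_posSet, integral_prod_symm _ hint]
  refine integral_eq_zero_of_ae ?_
  have hae : ∀ᵐ z ∂(volume.restrict (Set.Ioi (0 : ℝ))).prod (posPi n), ∀ i, 0 < z.2 i :=
    Measure.quasiMeasurePreserving_snd.ae (ae_posPi n)
  filter_upwards [hae] with z hz
  set μ := M.cmean n Y z.2 with hμ
  have h := integral_sub_left_eq_self (fun β => M.jd n Y β z.1 z.2 * (v ⬝ᵥ M.K n *ᵥ (β - μ)))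
    volume ((2 : ℝ) • μ)
  have h2 : ∀ β, M.jd n Y ((2 : ℝ) • μ - β) z.1 z.2 * (v ⬝ᵥ M.K n *ᵥ ((2 : ℝ) • μ - β - μ)) =
      -(M.jd n Y β z.1 z.2 * (v ⬝ᵥ M.K n *ᵥ (β - μ))) := fun β => by
    have e : (2 : ℝ) • μ - β - μ = -(β - μ) := by rw [two_smul]; abel
    rw [jd_eq ht _ _ _ hz, jd_eq ht _ _ _ hz, ← cmean, ← hμ, e, mulVec_neg, dotProduct_neg]
    have e2 : precForm (M.K n) (M.dvec n z.2) (-(β - μ)) =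
        precForm (M.K n) (M.dvec n z.2) (β - μ) := by
      generalize β - μ = x
      simp [precForm, mulVec_neg, sqnorm]
    rw [e2]; ring
  simp only [h2] at h
  rw [integral_neg] at h
  simp only [Pi.zero_apply]
  linarith

lemma sqnorm_mulVec_postMean (ht : 0 < M.τsq n) (Y : Fin n → ℝ) :
    M.postMean n Y = 0 ∨ (0 < M.Z n Y ∧
      IntegrableOn (fun p => M.jd n Y p.1 p.2.1 p.2.2) (posSet n) ∧
      IntegrableOn (fun p => M.jd n Y p.1 p.2.1 p.2.2 * M.expl n Y p.2.2) (posSet n) ∧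
      sqnorm (M.K n *ᵥ M.postMean n Y) * M.Z n Y ≤
        ∫ p in posSet n, M.jd n Y p.1 p.2.1 p.2.2 * M.expl n Y p.2.2) := by
  by_cases hZ : M.Z n Y = 0
  · left; simp [postMean, hZ]
  by_cases hi : IntegrableOn (fun p => M.jd n Y p.1 p.2.1 p.2.2 • p.1) (posSet n)
  swap
  · left
    have h0 : ∫ p in posSet n, M.jd n Y p.1 p.2.1 p.2.2 • p.1 = 0 := integral_undef hi
    rw [postMean, h0, smul_zero]
  right
  have hjd : IntegrableOn (fun p => M.jd n Y p.1 p.2.1 p.2.2) (posSet n) := by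
    by_contra h
    exact hZ (integral_undef h)
  have hae := ae_posSet n
  have hZpos : 0 < M.Z n Y := by
    refine lt_of_le_of_ne ?_ (Ne.symm hZ)
    rw [Z]
    refine integral_nonneg_of_ae ?_
    filter_upwards [hae] with p hp
    exact M.jd_nonneg Y _ hp.1 hp.2
  have hQm : Measurable fun p : (Fin n → ℝ) × ℝ × (Fin n → ℝ) => M.expl n Y p.2.2 :=
    (M.measurable_expl_right n Y).comp (measurable_snd.comp measurable_snd)
  have hQi : IntegrableOn (fun p => M.jd n Y p.1 p.2.1 p.2.2 * M.expl n Y p.2.2) (posSet n) := by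
    refine integrable_mul_of_bound (c := sqnorm Y) hjd hQm ?_
    · filter_upwards [hae] with p hp
      rw [abs_of_nonneg (expl_nonneg ht Y hp.2)]
      exact expl_le ht Y hp.2
  refine ⟨hZpos, hjd, hQi, ?_⟩
  set v := M.K n *ᵥ M.postMean n Y with hv
  obtain ⟨L, hL⟩ : ∃ L : (Fin n → ℝ) →L[ℝ] ℝ, ∀ x, L x = v ⬝ᵥ M.K n *ᵥ x :=
    ⟨LinearMap.toContinuousLinearMap
      { toFun := fun x => v ⬝ᵥ M.K n *ᵥ x
        map_add' := fun x y => by simp [mulVec_add]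
        map_smul' := fun r x => by simp [mulVec_smul] }, fun _ => rfl⟩
  have hμm := M.measurable_cmean n Y
  have hLi : IntegrableOn (fun p => M.jd n Y p.1 p.2.1 p.2.2 * L p.1) (posSet n) :=
    (integrable_mul_clm hi L).1
  have hle : ∀ l : Fin n → ℝ, (∀ i, 0 < l i) →
      sqnorm (M.K n *ᵥ M.cmean n Y l) ≤ M.expl n Y l := fun l hl =>
    sqnorm_mulVec_condMean_le (M.hK n).isHermitian (dvec_pos ht hl) Y
  have hLm : Measurable fun p : (Fin n → ℝ) × ℝ × (Fin n → ℝ) => L (M.cmean n Y p.2.2) :=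
    L.continuous.measurable.comp (hμm.comp (measurable_snd.comp measurable_snd))
  have hμi : IntegrableOn (fun p => M.jd n Y p.1 p.2.1 p.2.2 * L (M.cmean n Y p.2.2)) (posSet n) := by
    refine integrable_mul_of_bound (c := sqnorm v + sqnorm Y) hjd hLm ?_
    · filter_upwards [hae] with p hp
      rw [hL, abs_le]
      have h1 := (hle _ hp.2).trans (expl_le ht Y hp.2)
      have h2 := two_dotProduct_le v (M.K n *ᵥ M.cmean n Y p.2.2)
      have h3 := sqnorm_nonneg (v + M.K n *ᵥ M.cmean n Y p.2.2)
      rw [sqnorm_add] at h3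
      have h4 := sqnorm_nonneg v
      have h5 := sqnorm_nonneg Y
      constructor <;> linarith
  have hodd := M.integral_jd_odd ht Y v (by
    refine (hLi.sub hμi).congr (ae_of_all _ fun p => ?_)
    simp only [Pi.sub_apply, hL, mulVec_sub, dotProduct_sub]; ring)
  have heq : ∫ p in posSet n, M.jd n Y p.1 p.2.1 p.2.2 * L p.1 =
      ∫ p in posSet n, M.jd n Y p.1 p.2.1 p.2.2 * L (M.cmean n Y p.2.2) := by
    rw [← sub_eq_zero, ← integral_sub hLi hμi, ← hodd]
    refine integral_congr_ae (ae_of_all _ fun p => ?_)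
    simp only [hL, mulVec_sub, dotProduct_sub]; ring
  have hF : sqnorm v * M.Z n Y = ∫ p in posSet n, M.jd n Y p.1 p.2.1 p.2.2 * L p.1 := by
    have h1 : sqnorm v = L (M.postMean n Y) := by rw [hL, ← hv]; rfl
    rw [(integrable_mul_clm hi L).2, h1, postMean, map_smul, smul_eq_mul, mul_comm,
      mul_inv_cancel_left₀ hZ]
  have hbd : ∫ p in posSet n, M.jd n Y p.1 p.2.1 p.2.2 * L (M.cmean n Y p.2.2) ≤
      ∫ p in posSet n, (M.jd n Y p.1 p.2.1 p.2.2 * (sqnorm v / 2) +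
        M.jd n Y p.1 p.2.1 p.2.2 * M.expl n Y p.2.2 * (1 / 2)) := by
    refine integral_mono_ae hμi ((hjd.mul_const _).add (hQi.mul_const _)) ?_
    filter_upwards [hae] with p hp
    have h2 := two_dotProduct_le v (M.K n *ᵥ M.cmean n Y p.2.2)
    have h3 := hle _ hp.2
    have h4 := M.jd_nonneg Y p.1 hp.1 hp.2
    rw [hL]
    nlinarith
  rw [integral_add (hjd.mul_const _) (hQi.mul_const _), integral_mul_const, integral_mul_const,
    ← heq, ← hF] at hbd
  change _ ≤ M.Z n Y * (sqnorm v / 2) + _ at hbd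
  linarith

end Model

/-- A Young-type inequality separating an exponentially integrable factor from a small one. -/
lemma mul_le_exp_add_log {A y δ : ℝ} (hy0 : 0 ≤ y) (hy1 : y ≤ 1) (hδ : 0 < δ) :
    A * y ≤ δ * Real.exp A + Real.log (1 + (y / δ) ^ 2) := by
  have hlog : 0 ≤ Real.log (1 + (y / δ) ^ 2) := Real.log_nonneg (by nlinarith [sq_nonneg (y / δ)])
  rcases hy0.eq_or_lt with rfl | hy
  · have := Real.exp_pos A
    simp; positivity
  set z := y / δ with hz
  have hzp : 0 < z := div_pos hy hδ
  have hyz : y = δ * z := by rw [hz]; field_simp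
  have h1 : A - Real.log z + 1 ≤ Real.exp A / z := by
    have := Real.add_one_le_exp (A - Real.log z)
    rwa [Real.exp_sub, Real.exp_log hzp] at this
  have h2 : y * (A - Real.log z) ≤ δ * Real.exp A := by
    have h3 : y * (Real.exp A / z) = δ * Real.exp A := by rw [hyz]; field_simp
    nlinarith
  have h4 : y * Real.log z ≤ Real.log (1 + z ^ 2) := by
    rcases le_total (Real.log z) 0 with h | h
    · nlinarith
    · calc y * Real.log z ≤ Real.log z := mul_le_of_le_one_left h hy1
        _ ≤ _ := Real.log_le_log hzp (by nlinarith [sq_nonneg (z - 1)])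
  linarith

lemma log_one_add_le {x : ℝ} (hx : 0 ≤ x) : Real.log (1 + x) ≤ 2 * √x := by
  have h1 : Real.log (1 + x) ≤ Real.log ((1 + √x) ^ 2) :=
    Real.log_le_log (by linarith) (by nlinarith [Real.sq_sqrt hx, Real.sqrt_nonneg x])
  have h2 := Real.log_le_sub_one_of_pos (x := 1 + √x) (by positivity)
  rw [Real.log_pow] at h1
  push_cast at h1
  linarith

lemma log_ratio_le {b S Q : ℝ} (hb : 0 < b) (hS : 0 < S) (hQ0 : 0 ≤ Q) (hQS : Q ≤ S) :
    Real.log ((b + S) / (b + (S - Q))) ≤ Q / S * Real.log (1 + S / b) := by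
  have hw1 : Q / S ≤ 1 := (div_le_one hS).2 hQS
  have hw0 : 0 ≤ Q / S := by positivity
  have h := strictConcaveOn_log_Ioi.concaveOn.2 (x := b + S) (y := b)
    (Set.mem_Ioi.2 (by linarith)) (Set.mem_Ioi.2 hb) (sub_nonneg.2 hw1) hw0 (by ring)
  simp only [smul_eq_mul] at h
  have e1 : (1 - Q / S) * (b + S) + Q / S * b = b + (S - Q) := by field_simp; ring
  have e2 : 1 + S / b = (b + S) / b := by field_simp
  rw [e1] at h
  rw [e2, Real.log_div (by linarith) hb.ne', Real.log_div (by linarith) (by linarith)]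
  linarith

/-- For large `S`, the Student-type factor is absorbed by an exponential. -/
lemma exp_le_exp_mul_ratio_rpow {a b c S Q : ℝ} (ha : 0 < a) (hb : 0 < b) (hc : 0 < c)
    (hS : a ^ 2 / (b * c ^ 2) ≤ S) (hQ0 : 0 ≤ Q) (hQS : Q ≤ S) :
    Real.exp (c * Q) ≤ Real.exp (2 * c * Q) * ((b + S) / (b + (S - Q))) ^ (-a / 2) := by
  have hS0 : 0 < S := lt_of_lt_of_le (by positivity) hS
  have hρ : 0 < (b + S) / (b + (S - Q)) := div_pos (by linarith) (by linarith)
  rw [Real.rpow_def_of_pos hρ, ← Real.exp_add]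
  apply Real.exp_le_exp.2
  have h1 := log_ratio_le hb hS0 hQ0 hQS
  have h2 := log_one_add_le (x := S / b) (by positivity)
  have h3 : a * √(S / b) ≤ c * S := by
    rw [← pow_le_pow_iff_left₀ (by positivity) (by positivity) two_ne_zero]
    rw [mul_pow, Real.sq_sqrt (by positivity)]
    rw [div_le_iff₀ (by positivity)] at hS
    have : a ^ 2 * (S / b) = a ^ 2 * S / b := by ring
    rw [this, div_le_iff₀ hb]
    nlinarith
  have h4 : Q / S * Real.log (1 + S / b) ≤ Q / S * (2 * √(S / b)) :=
    mul_le_mul_of_nonneg_left h2 (by positivity)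
  have h5 : Q / S * (a * √(S / b)) ≤ Q / S * (c * S) :=
    mul_le_mul_of_nonneg_left h3 (by positivity)
  have h6 : Q / S * (c * S) = c * Q := by field_simp
  nlinarith

namespace Model

variable (M : Model) {n : ℕ}

lemma aemeasurable_pr : AEMeasurable M.pr (volume.restrict (Set.Ioi (0 : ℝ))) := by
  by_contra h
  have h2 : ¬ IntegrableOn M.pr (Set.Ioi 0) := fun hi => h hi.aemeasurable
  have := M.hpr_int
  rw [integral_undef h2] at this
  exact zero_ne_one this

lemma aemeasurable_prod_pr (n : ℕ) :
    AEMeasurable (fun l : Fin n → ℝ => ∏ i, M.pr (l i)) (posPi n) := by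
  refine Finset.aemeasurable_fun_prod _ fun i _ => ?_
  exact M.aemeasurable_pr.comp_quasiMeasurePreserving (Measure.quasiMeasurePreserving_eval _ i)

lemma aemeasurable_jd (n : ℕ) (Y : Fin n → ℝ) :
    AEMeasurable (fun p : (Fin n → ℝ) × ℝ × (Fin n → ℝ) => M.jd n Y p.1 p.2.1 p.2.2)
      (volume.prod ((volume.restrict (Set.Ioi (0 : ℝ))).prod (posPi n))) := by
  have h1 : AEMeasurable (fun p : (Fin n → ℝ) × ℝ × (Fin n → ℝ) => ∏ i, M.pr (p.2.2 i))
      (volume.prod ((volume.restrict (Set.Ioi (0 : ℝ))).prod (posPi n))) :=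
    ((M.aemeasurable_prod_pr n).comp_quasiMeasurePreserving
      Measure.quasiMeasurePreserving_snd).comp_quasiMeasurePreserving
      Measure.quasiMeasurePreserving_snd
  have hs : Measurable fun p : (Fin n → ℝ) × ℝ × (Fin n → ℝ) =>
      sqnorm (Y - M.K n *ᵥ p.1) := by
    have : Continuous fun p : (Fin n → ℝ) × ℝ × (Fin n → ℝ) => Y - M.K n *ᵥ p.1 := by fun_prop
    exact (continuous_sqnorm.comp this).measurable
  unfold jd
  refine ((AEMeasurable.mul ?_ h1).mul ?_).mul ?_
  · exact (Measurable.pow_const (by fun_prop) _).aemeasurable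
  · exact (Measurable.pow_const (by fun_prop) _).aemeasurable
  · refine Measurable.aemeasurable ?_
    refine Real.measurable_exp.comp (Measurable.div (Measurable.sub ?_ hs) ?_) <;> fun_prop

lemma precForm_smul {K : Matrix (Fin n) (Fin n) ℝ} {d : Fin n → ℝ} (r : ℝ) (β : Fin n → ℝ) :
    precForm K d (r • β) = r ^ 2 * precForm K d β := by
  simp only [precForm, mulVec_smul, sqnorm_smul, Pi.smul_apply, smul_eq_mul, mul_add,
    Finset.mul_sum]
  congr 1
  exact Finset.sum_congr rfl fun i _ => by ring

lemma lintegral_exp_precForm {K : Matrix (Fin n) (Fin n) ℝ} {d : Fin n → ℝ} (μ : Fin n → ℝ)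
    {s : ℝ} (hs : 0 < s) :
    ∫⁻ β, ENNReal.ofReal (Real.exp (-precForm K d (β - μ) / (2 * s))) =
      ENNReal.ofReal (s ^ ((n : ℝ) / 2)) *
        ∫⁻ β, ENNReal.ofReal (Real.exp (-precForm K d β / 2)) := by
  rw [lintegral_sub_right_eq_self
    (fun β => ENNReal.ofReal (Real.exp (-precForm K d β / (2 * s)))) μ,
    lintegral_eq_scale volume _ (Real.sqrt_pos.2 hs)]
  have h : √s ^ Module.finrank ℝ (Fin n → ℝ) = s ^ ((n : ℝ) / 2) := by
    rw [Module.finrank_fin_fun, Real.sqrt_eq_rpow, ← Real.rpow_natCast, ← Real.rpow_mul hs.le]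
    congr 1; ring
  rw [h]
  congr 1
  refine lintegral_congr fun β => ?_
  rw [precForm_smul, Real.sq_sqrt hs.le]
  congr 2
  field_simp

lemma measurable_marg (K : Matrix (Fin n) (Fin n) ℝ) (t : ℝ) : Measurable (marg K t) := by
  unfold marg
  refine Measurable.mul ?_ ?_
  · exact (Measurable.pow_const (by fun_prop) _).ennreal_ofReal
  · have h : Measurable fun z : (Fin n → ℝ) × (Fin n → ℝ) =>
        precForm K (fun i => t⁻¹ / z.1 i) z.2 := by
      unfold precForm
      have h1 : Continuous fun z : (Fin n → ℝ) × (Fin n → ℝ) => K *ᵥ z.2 := by fun_prop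
      refine (continuous_sqnorm.comp h1).measurable.add ?_
      fun_prop
    have h2 : Measurable fun z : (Fin n → ℝ) × (Fin n → ℝ) =>
        ENNReal.ofReal (Real.exp (-precForm K (fun i => t⁻¹ / z.1 i) z.2 / 2)) := by fun_prop
    exact h2.lintegral_prod_right'

lemma measurable_resid (n : ℕ) (Y : Fin n → ℝ) : Measurable (M.resid n Y) := by
  have := M.measurable_expl_right n Y
  unfold resid
  fun_prop

lemma measurable_jd_right (Y : Fin n → ℝ) (s : ℝ) (l : Fin n → ℝ) :
    Measurable fun β => M.jd n Y β s l := by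
  have h1 : Continuous fun β : Fin n → ℝ => Y - M.K n *ᵥ β := by fun_prop
  have h2 : Measurable fun β => sqnorm (Y - M.K n *ᵥ β) := (continuous_sqnorm.comp h1).measurable
  unfold jd
  fun_prop

variable {M} in
lemma lintegral_jd_right (ht : 0 < M.τsq n) (Y : Fin n → ℝ) {s : ℝ} (hs : 0 < s) {l : Fin n → ℝ}
    (hl : ∀ i, 0 < l i) :
    ∫⁻ β, ENNReal.ofReal (M.jd n Y β s l) =
      ENNReal.ofReal (∏ i, M.pr (l i)) * marg (M.K n) (M.τsq n) l *
        ENNReal.ofReal (s ^ (-(((n : ℝ) + M.a) / 2) - 1) * Real.exp (-M.resid n Y l / (2 * s))) := by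
  have hpr : 0 ≤ ∏ i, M.pr (l i) := Finset.prod_nonneg fun i _ => M.hpr_nonneg _
  have hl' : 0 ≤ ∏ i, l i := Finset.prod_nonneg fun i _ => (hl i).le
  have h1 : ∀ β, ENNReal.ofReal (M.jd n Y β s l) = ENNReal.ofReal
      (s ^ (-(n : ℝ) - M.a / 2 - 1) * (∏ i, M.pr (l i)) * (∏ i, l i) ^ (-(1 : ℝ) / 2) *
        Real.exp (-M.resid n Y l / (2 * s))) *
      ENNReal.ofReal (Real.exp (-precForm (M.K n) (M.dvec n l)
        (β - condMean (M.K n) (M.dvec n l) Y) / (2 * s))) := fun β => by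
    rw [jd_eq ht Y β s hl, ← ENNReal.ofReal_mul (by positivity), neg_add, add_div, Real.exp_add]
    congr 1; ring
  simp only [h1]
  rw [lintegral_const_mul' _ _ ENNReal.ofReal_ne_top, lintegral_exp_precForm _ hs, marg]
  have h2 : (fun i => (M.τsq n)⁻¹ / l i) = M.dvec n l := rfl
  rw [h2, ← mul_assoc, ← mul_assoc, ← ENNReal.ofReal_mul (by positivity),
    ← ENNReal.ofReal_mul (by positivity)]
  rw [mul_right_comm _ _ (ENNReal.ofReal (s ^ (-(((n : ℝ) + M.a) / 2) - 1) * _)),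
    ← ENNReal.ofReal_mul (by positivity)]
  congr 2
  have h3 : s ^ (-(n : ℝ) - M.a / 2 - 1) * s ^ ((n : ℝ) / 2) =
      s ^ (-(((n : ℝ) + M.a) / 2) - 1) := by
    rw [← Real.rpow_add hs]; congr 1; ring
  rw [← h3]; ring

variable {M} in
/-- Integrating out the coefficients and the error variance. -/
lemma lintegral_jd_mul (ht : 0 < M.τsq n) (Y : Fin n → ℝ) {W : (Fin n → ℝ) → ℝ≥0∞}
    (hW : Measurable W) :
    ∫⁻ p in posSet n, ENNReal.ofReal (M.jd n Y p.1 p.2.1 p.2.2) * W p.2.2 =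
      invGammaMass (((n : ℝ) + M.a) / 2) * ∫⁻ l, ENNReal.ofReal (∏ i, M.pr (l i)) *
        marg (M.K n) (M.τsq n) l *
        (ENNReal.ofReal (M.resid n Y l ^ (-(((n : ℝ) + M.a) / 2))) * W l) ∂posPi n := by
  have hW2 : Measurable fun p : (Fin n → ℝ) × ℝ × (Fin n → ℝ) => W p.2.2 :=
    hW.comp (measurable_snd.comp measurable_snd)
  have hm : AEMeasurable (fun p : (Fin n → ℝ) × ℝ × (Fin n → ℝ) =>
      ENNReal.ofReal (M.jd n Y p.1 p.2.1 p.2.2) * W p.2.2)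
      (volume.prod ((volume.restrict (Set.Ioi (0 : ℝ))).prod (posPi n))) :=
    (M.aemeasurable_jd n Y).ennreal_ofReal.mul hW2.aemeasurable
  rw [restrict_posSet, lintegral_prod_symm _ hm, lintegral_prod_symm _ hm.lintegral_prod_left']
  have hm2 : AEMeasurable (fun l => ENNReal.ofReal (∏ i, M.pr (l i)) *
      marg (M.K n) (M.τsq n) l *
      (ENNReal.ofReal (M.resid n Y l ^ (-(((n : ℝ) + M.a) / 2))) * W l)) (posPi n) :=
    ((M.aemeasurable_prod_pr n).ennreal_ofReal.mul (measurable_marg _ _).aemeasurable).mul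
      ((((M.measurable_resid n Y).pow_const _).ennreal_ofReal.mul hW).aemeasurable)
  rw [← lintegral_const_mul'' _ hm2]
  refine lintegral_congr_ae ?_
  filter_upwards [ae_posPi n] with l hl
  have h1 : ∀ᵐ s ∂volume.restrict (Set.Ioi (0 : ℝ)),
      ∫⁻ β, ENNReal.ofReal (M.jd n Y β s l) * W l =
      ENNReal.ofReal (∏ i, M.pr (l i)) * marg (M.K n) (M.τsq n) l *
        ENNReal.ofReal (s ^ (-(((n : ℝ) + M.a) / 2) - 1) *
          Real.exp (-M.resid n Y l / (2 * s))) * W l := by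
    filter_upwards [ae_restrict_mem measurableSet_Ioi] with s hs
    rw [lintegral_mul_const _ (M.measurable_jd_right Y s l).ennreal_ofReal,
      lintegral_jd_right ht Y hs hl]
  rw [lintegral_congr_ae h1]
  have hr : 0 < M.resid n Y l := by
    have := expl_le ht Y hl
    have := M.hb
    rw [resid]; linarith
  have hm3 : Measurable fun s : ℝ => ENNReal.ofReal (s ^ (-(((n : ℝ) + M.a) / 2) - 1) *
      Real.exp (-M.resid n Y l / (2 * s))) := by fun_prop
  rw [lintegral_mul_const _ (hm3.const_mul _), lintegral_const_mul _ hm3, lintegral_invGamma _ hr]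
  ring

/-- The ratio between the total and the residual scale. -/
def ratio (n : ℕ) (Y l : Fin n → ℝ) : ℝ := (M.b + sqnorm Y) / M.resid n Y l

variable {M} in
lemma resid_pos (ht : 0 < M.τsq n) (Y : Fin n → ℝ) {l : Fin n → ℝ} (hl : ∀ i, 0 < l i) :
    0 < M.resid n Y l := by
  have := expl_le ht Y hl
  have := M.hb
  rw [resid]; linarith

variable {M} in
lemma resid_le (ht : 0 < M.τsq n) (Y : Fin n → ℝ) {l : Fin n → ℝ} (hl : ∀ i, 0 < l i) :
    M.resid n Y l ≤ M.b + sqnorm Y := by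
  have := expl_nonneg ht Y hl
  rw [resid]; linarith

lemma total_pos (Y : Fin n → ℝ) : 0 < M.b + sqnorm Y :=
  add_pos_of_pos_of_nonneg M.hb (sqnorm_nonneg Y)

variable {M} in
lemma ratio_pos (ht : 0 < M.τsq n) (Y : Fin n → ℝ) {l : Fin n → ℝ} (hl : ∀ i, 0 < l i) :
    0 < M.ratio n Y l := div_pos (M.total_pos Y) (resid_pos ht Y hl)

/-- Prior mass of the local parameters, weighted by the Gaussian marginal factor. -/
def mass (n : ℕ) : ℝ≥0∞ :=
  ∫⁻ l, ENNReal.ofReal (∏ i, M.pr (l i)) * marg (M.K n) (M.τsq n) l ∂posPi n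

/-- Weighted prior average of the ratio between the total and the residual scale. -/
def tilt (n : ℕ) (T : (Fin n → ℝ) → ℝ) (Y : Fin n → ℝ) : ℝ≥0∞ :=
  ∫⁻ l, ENNReal.ofReal (∏ i, M.pr (l i)) * marg (M.K n) (M.τsq n) l *
    ENNReal.ofReal (M.ratio n Y l ^ ((n : ℝ) / 2) * T l) ∂posPi n

variable {M} in
lemma mass_le_lintegral_jd (ht : 0 < M.τsq n) (Y : Fin n → ℝ) :
    invGammaMass (((n : ℝ) + M.a) / 2) *
        (ENNReal.ofReal ((M.b + sqnorm Y) ^ (-(((n : ℝ) + M.a) / 2))) * M.mass n) ≤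
      ∫⁻ p in posSet n, ENNReal.ofReal (M.jd n Y p.1 p.2.1 p.2.2) := by
  have h := lintegral_jd_mul (W := fun _ => 1) ht Y measurable_const
  simp only [mul_one] at h
  rw [h, mass, ← lintegral_const_mul' _ _ ENNReal.ofReal_ne_top]
  refine mul_le_mul_right (lintegral_mono_ae ?_) _
  filter_upwards [ae_posPi n] with l hl
  rw [mul_comm]
  refine mul_le_mul_right (ENNReal.ofReal_le_ofReal ?_) _
  refine Real.rpow_le_rpow_of_nonpos (resid_pos ht Y hl) (resid_le ht Y hl) ?_
  have := M.ha
  have : (0 : ℝ) ≤ n := n.cast_nonneg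
  linarith

variable {M} in
lemma lintegral_jd_tilt (ht : 0 < M.τsq n) (Y : Fin n → ℝ) {T : (Fin n → ℝ) → ℝ}
    (hT : Measurable T) :
    ∫⁻ p in posSet n, ENNReal.ofReal (M.jd n Y p.1 p.2.1 p.2.2) *
        ENNReal.ofReal (T p.2.2 * M.ratio n Y p.2.2 ^ (-M.a / 2)) =
      invGammaMass (((n : ℝ) + M.a) / 2) *
        (ENNReal.ofReal ((M.b + sqnorm Y) ^ (-(((n : ℝ) + M.a) / 2))) * M.tilt n T Y) := by
  have hm : Measurable fun l => ENNReal.ofReal (T l * M.ratio n Y l ^ (-M.a / 2)) := by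
    have := M.measurable_resid n Y
    unfold ratio
    fun_prop
  rw [lintegral_jd_mul ht Y hm, tilt, ← lintegral_const_mul' _ _ ENNReal.ofReal_ne_top]
  congr 1
  refine lintegral_congr_ae ?_
  filter_upwards [ae_posPi n] with l hl
  have hr := resid_pos ht Y hl
  have hρ := ratio_pos ht Y hl
  have h0 := M.total_pos Y
  rw [← ENNReal.ofReal_mul (by positivity),
    mul_left_comm (ENNReal.ofReal ((M.b + sqnorm Y) ^ (-(((n : ℝ) + M.a) / 2)))), ← ENNReal.ofReal_mul (by positivity)]
  congr 2
  have h1 : M.resid n Y l ^ (-(((n : ℝ) + M.a) / 2)) =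
      (M.b + sqnorm Y) ^ (-(((n : ℝ) + M.a) / 2)) * M.ratio n Y l ^ (((n : ℝ) + M.a) / 2) := by
    rw [ratio, Real.div_rpow h0.le hr.le, Real.rpow_neg h0.le, Real.rpow_neg hr.le]
    have : (M.b + sqnorm Y) ^ (((n : ℝ) + M.a) / 2) ≠ 0 := (Real.rpow_pos_of_pos h0 _).ne'
    field_simp
  have h2 : M.ratio n Y l ^ (((n : ℝ) + M.a) / 2) * M.ratio n Y l ^ (-M.a / 2) =
      M.ratio n Y l ^ ((n : ℝ) / 2) := by
    rw [← Real.rpow_add hρ]; congr 1; ring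
  rw [h1, ← h2]; ring

variable {M} in
/-- A Laplace-transform bound on the norm of the posterior mean. -/
lemma postMean_bound (ht : 0 < M.τsq n) (Y : Fin n → ℝ) {T : (Fin n → ℝ) → ℝ}
    (hT : Measurable T) (hT0 : ∀ l, 0 ≤ T l) {c Φ m : ℝ} (hc : 0 ≤ c) (hm : 0 ≤ m)
    {D : ℝ≥0∞} (hD : D ≤ M.mass n) (h : ∀ l : Fin n → ℝ, (∀ i, 0 < l i) →
      Real.exp (c * M.expl n Y l) ≤ Real.exp Φ * (T l * M.ratio n Y l ^ (-M.a / 2))) :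
    ENNReal.ofReal (c * sqnorm (M.K n *ᵥ M.postMean n Y)) * D ≤
      ENNReal.ofReal m * D + ENNReal.ofReal (Real.exp (Φ - m)) * M.tilt n T Y := by
  rcases M.sqnorm_mulVec_postMean ht Y with h0 | ⟨hZ, hjd, hQ, hF⟩
  · simp [h0, sqnorm]
  set F := sqnorm (M.K n *ᵥ M.postMean n Y) with hFdef
  have hF0 : 0 ≤ F := sqnorm_nonneg _
  have hae := ae_posSet n
  have hZl : ENNReal.ofReal (M.Z n Y) =
      ∫⁻ p in posSet n, ENNReal.ofReal (M.jd n Y p.1 p.2.1 p.2.2) := by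
    rw [Z]
    refine ofReal_integral_eq_lintegral_ofReal hjd ?_
    filter_upwards [hae] with p hp
    exact M.jd_nonneg Y _ hp.1 hp.2
  have hQl : ENNReal.ofReal (∫ p in posSet n, M.jd n Y p.1 p.2.1 p.2.2 * M.expl n Y p.2.2) =
      ∫⁻ p in posSet n, ENNReal.ofReal (M.jd n Y p.1 p.2.1 p.2.2 * M.expl n Y p.2.2) := by
    refine ofReal_integral_eq_lintegral_ofReal hQ ?_
    filter_upwards [hae] with p hp
    exact mul_nonneg (M.jd_nonneg Y _ hp.1 hp.2) (expl_nonneg ht Y hp.2)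
  have hjdm : AEMeasurable (fun p : (Fin n → ℝ) × ℝ × (Fin n → ℝ) =>
      ENNReal.ofReal (M.jd n Y p.1 p.2.1 p.2.2)) (volume.restrict (posSet n)) :=
    hjd.aemeasurable.ennreal_ofReal
  have key : ENNReal.ofReal (c * F) * ENNReal.ofReal (M.Z n Y) ≤
      ENNReal.ofReal m * ENNReal.ofReal (M.Z n Y) + ENNReal.ofReal (Real.exp (Φ - m)) *
        ∫⁻ p in posSet n, ENNReal.ofReal (M.jd n Y p.1 p.2.1 p.2.2) *
        ENNReal.ofReal (T p.2.2 * M.ratio n Y p.2.2 ^ (-M.a / 2)) := by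
    calc ENNReal.ofReal (c * F) * ENNReal.ofReal (M.Z n Y)
        = ENNReal.ofReal c * ENNReal.ofReal (F * M.Z n Y) := by
          rw [ENNReal.ofReal_mul hc, ENNReal.ofReal_mul hF0, mul_assoc]
      _ ≤ ENNReal.ofReal c * ∫⁻ p in posSet n,
          ENNReal.ofReal (M.jd n Y p.1 p.2.1 p.2.2 * M.expl n Y p.2.2) := by
          rw [← hQl]
          exact mul_le_mul_right (ENNReal.ofReal_le_ofReal hF) _
      _ ≤ ∫⁻ p in posSet n, (ENNReal.ofReal m * ENNReal.ofReal (M.jd n Y p.1 p.2.1 p.2.2) +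
          ENNReal.ofReal (Real.exp (Φ - m)) * (ENNReal.ofReal (M.jd n Y p.1 p.2.1 p.2.2) *
          ENNReal.ofReal (T p.2.2 * M.ratio n Y p.2.2 ^ (-M.a / 2)))) := by
          rw [← lintegral_const_mul' _ _ ENNReal.ofReal_ne_top]
          refine lintegral_mono_ae ?_
          filter_upwards [hae] with p hp
          have hj := M.jd_nonneg Y p.1 hp.1 hp.2
          have hρ := ratio_pos ht Y hp.2
          have hTp := hT0 p.2.2
          rw [← ENNReal.ofReal_mul hc, ← ENNReal.ofReal_mul hm, ← ENNReal.ofReal_mul hj,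
            ← ENNReal.ofReal_mul (Real.exp_pos _).le, ← ENNReal.ofReal_add (by positivity)
            (by positivity)]
          refine ENNReal.ofReal_le_ofReal ?_
          have h1 := h p.2.2 hp.2
          have h2 := Real.add_one_le_exp (c * M.expl n Y p.2.2 - m)
          have h3 : Real.exp (c * M.expl n Y p.2.2 - m) ≤
              Real.exp (Φ - m) * (T p.2.2 * M.ratio n Y p.2.2 ^ (-M.a / 2)) := by
            rw [sub_eq_add_neg, sub_eq_add_neg, Real.exp_add, Real.exp_add]
            have := mul_le_mul_of_nonneg_right h1 (Real.exp_pos (-m)).le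
            linarith
          have h4 := mul_le_mul_of_nonneg_left
            (show c * M.expl n Y p.2.2 ≤ m +
              Real.exp (Φ - m) * (T p.2.2 * M.ratio n Y p.2.2 ^ (-M.a / 2)) by linarith) hj
          linarith
      _ = _ := by
          rw [lintegral_add_left' (hjdm.const_mul _), lintegral_const_mul' _ _
            ENNReal.ofReal_ne_top, lintegral_const_mul' _ _ ENNReal.ofReal_ne_top, ← hZl]
  have hN : (∫⁻ p in posSet n, ENNReal.ofReal (M.jd n Y p.1 p.2.1 p.2.2) *
        ENNReal.ofReal (T p.2.2 * M.ratio n Y p.2.2 ^ (-M.a / 2))) * D ≤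
      ENNReal.ofReal (M.Z n Y) * M.tilt n T Y := by
    refine (mul_le_mul_right hD _).trans ?_
    rw [lintegral_jd_tilt ht Y hT, hZl]
    calc _ = invGammaMass (((n : ℝ) + M.a) / 2) *
          (ENNReal.ofReal ((M.b + sqnorm Y) ^ (-(((n : ℝ) + M.a) / 2))) * M.mass n) *
            M.tilt n T Y := by ring
      _ ≤ _ := mul_le_mul_left (mass_le_lintegral_jd ht Y) _
  have hfin : ENNReal.ofReal (M.Z n Y) *
      (ENNReal.ofReal (c * F) * D) ≤ ENNReal.ofReal (M.Z n Y) *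
      (ENNReal.ofReal m * D + ENNReal.ofReal (Real.exp (Φ - m)) * M.tilt n T Y) := by
    calc _ = ENNReal.ofReal (c * F) * ENNReal.ofReal (M.Z n Y) * D := by ring
      _ ≤ _ := mul_le_mul_left key _
      _ = ENNReal.ofReal (M.Z n Y) * (ENNReal.ofReal m * D) +
          ENNReal.ofReal (Real.exp (Φ - m)) * ((∫⁻ p in posSet n,
          ENNReal.ofReal (M.jd n Y p.1 p.2.1 p.2.2) *
          ENNReal.ofReal (T p.2.2 * M.ratio n Y p.2.2 ^ (-M.a / 2))) * D) := by ring
      _ ≤ ENNReal.ofReal (M.Z n Y) * (ENNReal.ofReal m * D) +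
          ENNReal.ofReal (Real.exp (Φ - m)) * (ENNReal.ofReal (M.Z n Y) * M.tilt n T Y) := by
          gcongr
      _ = _ := by ring
  exact (ENNReal.mul_le_mul_iff_right (ENNReal.ofReal_pos.2 hZ).ne' ENNReal.ofReal_ne_top).1 hfin

lemma integrableOn_pr : IntegrableOn M.pr (Set.Ioi (0 : ℝ)) := by
  by_contra h
  have := M.hpr_int
  rw [integral_undef h] at this
  exact zero_ne_one this

variable {M} in
lemma integrableOn_id_mul_pr (hmom : M.Moment4) :
    IntegrableOn (fun x => x * M.pr x) (Set.Ioi (0 : ℝ)) := by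
  refine Integrable.mono' (M.integrableOn_pr.add hmom)
    (measurable_id.aestronglyMeasurable.mul M.aemeasurable_pr.aestronglyMeasurable) ?_
  filter_upwards [ae_restrict_mem measurableSet_Ioi] with x hx
  have hx : 0 < x := hx
  have h1 := M.hpr_nonneg x
  simp only [Pi.add_apply, Real.norm_eq_abs]
  rw [abs_of_nonneg (by positivity)]
  nlinarith [sq_nonneg (x - 1), mul_nonneg h1 (sq_nonneg (x - 1)), mul_nonneg h1 (sq_nonneg x)]

variable {M} in
/-- Jensen's inequality for the Laplace transform of the prior. -/
lemma exp_le_lintegral_pr (hmom : M.Moment4) {κ : ℝ} (hκ : 0 ≤ κ) :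
    ENNReal.ofReal (Real.exp (-(κ * ∫ x in Set.Ioi (0 : ℝ), x * M.pr x))) ≤
      ∫⁻ x in Set.Ioi (0 : ℝ), ENNReal.ofReal (M.pr x * Real.exp (-κ * x)) := by
  set m1 := ∫ x in Set.Ioi (0 : ℝ), x * M.pr x with hm1
  have h1 := M.integrableOn_pr
  have h2 := integrableOn_id_mul_pr hmom
  have hi : IntegrableOn (fun x => M.pr x * Real.exp (-κ * x)) (Set.Ioi (0 : ℝ)) := by
    refine integrable_mul_of_bound (c := 1) h1 (by fun_prop) ?_
    filter_upwards [ae_restrict_mem measurableSet_Ioi] with x hx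
    have hx : 0 < x := hx
    rw [abs_of_pos (Real.exp_pos _), Real.exp_le_one_iff]
    nlinarith [mul_nonneg hκ hx.le]
  rw [← ofReal_integral_eq_lintegral_ofReal hi (ae_of_all _ fun x =>
    mul_nonneg (M.hpr_nonneg x) (Real.exp_pos _).le)]
  refine ENNReal.ofReal_le_ofReal ?_
  have h3 : ∫ x in Set.Ioi (0 : ℝ), (M.pr x * (Real.exp (-(κ * m1)) * (1 + κ * m1)) -
      x * M.pr x * (Real.exp (-(κ * m1)) * κ)) = Real.exp (-(κ * m1)) := by
    rw [integral_sub (h1.mul_const _) (h2.mul_const _), integral_mul_const, integral_mul_const,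
      M.hpr_int, ← hm1]
    ring
  rw [← h3]
  refine integral_mono ((h1.mul_const _).sub (h2.mul_const _)) hi fun x => ?_
  have h4 := Real.add_one_le_exp (κ * m1 - κ * x)
  have h5 : Real.exp (-κ * x) = Real.exp (-(κ * m1)) * Real.exp (κ * m1 - κ * x) := by
    rw [← Real.exp_add]; congr 1; ring
  have h6 := mul_le_mul_of_nonneg_left h4
    (mul_nonneg (M.hpr_nonneg x) (Real.exp_pos (-(κ * m1))).le)
  simp only
  rw [h5]
  linarith

lemma lintegral_prod_pr {g : ℝ → ℝ} (hg : Measurable g) (hg0 : ∀ x, 0 ≤ g x) :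
    ∫⁻ l, ENNReal.ofReal (∏ i, M.pr (l i)) * ENNReal.ofReal (∏ i, g (l i)) ∂posPi n =
      (∫⁻ x in Set.Ioi (0 : ℝ), ENNReal.ofReal (M.pr x * g x)) ^ n := by
  have h : ∀ l : Fin n → ℝ, ENNReal.ofReal (∏ i, M.pr (l i)) * ENNReal.ofReal (∏ i, g (l i)) =
      ∏ i, ENNReal.ofReal (M.pr (l i) * g (l i)) := fun l => by
    rw [← ENNReal.ofReal_mul (Finset.prod_nonneg fun i _ => M.hpr_nonneg _),
      ← Finset.prod_mul_distrib, ENNReal.ofReal_prod_of_nonneg]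
    exact fun i _ => mul_nonneg (M.hpr_nonneg _) (hg0 _)
  simp only [h, posPi]
  rw [lintegral_pi_prod (fun _ x => ENNReal.ofReal (M.pr x * g x))
    (fun _ => (M.aemeasurable_pr.mul hg.aemeasurable).ennreal_ofReal)]
  simp

variable {M} in
lemma mass_ge (ht : 0 < M.τsq n) (hmom : M.Moment4) {c : ℝ}
    (hc : ∀ x, sqnorm (M.K n *ᵥ x) ≤ c ^ 2 * sqnorm x) :
    ENNReal.ofReal ((2 * Real.pi * M.τsq n) ^ ((n : ℝ) / 2) *
      Real.exp (-(n * (c ^ 2 * M.τsq n / 2 * ∫ x in Set.Ioi (0 : ℝ), x * M.pr x)))) ≤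
      M.mass n := by
  have hpi := Real.pi_pos
  have h1 := pow_le_pow_left₀ zero_le
    (exp_le_lintegral_pr hmom (κ := c ^ 2 * M.τsq n / 2) (by positivity)) n
  rw [← M.lintegral_prod_pr (by fun_prop) fun x => (Real.exp_pos _).le,
    ← ENNReal.ofReal_pow (Real.exp_pos _).le, ← Real.exp_nat_mul, mul_neg] at h1
  rw [ENNReal.ofReal_mul (by positivity)]
  refine (mul_le_mul_right h1 _).trans ?_
  rw [mass, ← lintegral_const_mul' _ _ ENNReal.ofReal_ne_top]
  refine lintegral_mono_ae ?_
  filter_upwards [ae_posPi n] with l hl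
  refine le_trans (le_of_eq ?_) (mul_le_mul_right (marg_ge ht hl hc) _)
  rw [mul_left_comm, ← ENNReal.ofReal_mul (by positivity), ← Real.exp_sum, Finset.mul_sum]

variable {M} in
lemma lintegral_pr_quadratic_le (hmom : M.Moment4) (r : ℝ) :
    ∫⁻ x in Set.Ioi (0 : ℝ), ENNReal.ofReal (M.pr x * (1 + (r * x) ^ 2)) ≤
      ENNReal.ofReal (Real.exp (r ^ 2 * ∫ x in Set.Ioi (0 : ℝ), x ^ 2 * M.pr x)) := by
  have h1 := M.integrableOn_pr
  have e : ∀ x, M.pr x * (1 + (r * x) ^ 2) = M.pr x + x ^ 2 * M.pr x * r ^ 2 := fun x => by ring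
  have hmr := Integrable.mul_const hmom (r ^ 2)
  simp only [e]
  have hs : IntegrableOn (fun x => M.pr x + x ^ 2 * M.pr x * r ^ 2) (Set.Ioi 0) := h1.add hmr
  rw [← ofReal_integral_eq_lintegral_ofReal hs (ae_of_all _ fun x => by
    have := M.hpr_nonneg x
    simp only [Pi.zero_apply]; positivity)]
  refine ENNReal.ofReal_le_ofReal ?_
  rw [integral_add h1 hmr, integral_mul_const, M.hpr_int]
  have := Real.add_one_le_exp (r ^ 2 * ∫ x in Set.Ioi (0 : ℝ), x ^ 2 * M.pr x)
  linarith

/-- Density of `N(0, σ₀² I)`. -/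
def refDens (n : ℕ) (Y : Fin n → ℝ) : ℝ :=
  (2 * Real.pi * M.σ0sq) ^ (-(n : ℝ) / 2) * Real.exp (-sqnorm Y / (2 * M.σ0sq))

lemma refDens_pos (Y : Fin n → ℝ) : 0 < M.refDens n Y := by
  have hpi := Real.pi_pos
  have hσ := M.hσ0
  unfold refDens
  positivity

variable {M} in
lemma lintegral_ratio_le (hn : n ≠ 0) (ht : 0 < M.τsq n) {l : Fin n → ℝ} (hl : ∀ i, 0 < l i) :
    marg (M.K n) (M.τsq n) l *
        ∫⁻ Y, ENNReal.ofReal (M.ratio n Y l ^ ((n : ℝ) / 2) * M.refDens n Y) ≤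
      ENNReal.ofReal ((2 * Real.pi * M.τsq n) ^ ((n : ℝ) / 2)) := by
  have hpi := Real.pi_pos
  have hσ := M.hσ0
  rw [← marg_mul_lintegral hn (M.hK n).isHermitian ht hl hσ]
  refine mul_le_mul_right (lintegral_mono_ae ?_) _
  have : Nonempty (Fin n) := ⟨⟨0, Nat.pos_of_ne_zero hn⟩⟩
  have hne : ∀ᵐ Y : Fin n → ℝ, Y ≠ 0 := by
    rw [ae_iff]; simp
  filter_upwards [hne] with Y hY
  refine ENNReal.ofReal_le_ofReal (mul_le_mul_of_nonneg_right ?_ (M.refDens_pos Y).le)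
  have h2 : (fun i => (M.τsq n)⁻¹ / l i) = M.dvec n l := rfl
  have h3 : fitQ (M.K n) (M.dvec n l) Y < sqnorm Y :=
    fitQ_lt (M.hK n).isHermitian (dvec_pos ht hl) hY
  have h4 := expl_nonneg ht Y hl
  have h5 := M.hb
  refine Real.rpow_le_rpow (ratio_pos ht Y hl).le ?_ (by positivity)
  rw [h2, ← expl, ratio, resid]
  rw [← expl] at h3
  rw [div_le_div_iff₀ (by linarith) (by linarith)]
  nlinarith

lemma measurable_ratio (n : ℕ) :
    Measurable fun z : (Fin n → ℝ) × (Fin n → ℝ) => M.ratio n z.1 z.2 := by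
  have h1 := M.measurable_expl n
  have h2 : Measurable fun z : (Fin n → ℝ) × (Fin n → ℝ) => sqnorm z.1 :=
    continuous_sqnorm.measurable.comp measurable_fst
  unfold ratio resid
  fun_prop

lemma measurable_refDens (n : ℕ) : Measurable (M.refDens n) := by
  have h : Measurable (sqnorm : (Fin n → ℝ) → ℝ) := continuous_sqnorm.measurable
  unfold refDens
  fun_prop

variable {M} in
lemma lintegral_tilt_le (hn : n ≠ 0) (ht : 0 < M.τsq n) (hmom : M.Moment4) (r : ℝ) :
    ∫⁻ Y, M.tilt n (fun l => ∏ i, (1 + (r * l i) ^ 2)) Y * ENNReal.ofReal (M.refDens n Y) ≤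
      ENNReal.ofReal ((2 * Real.pi * M.τsq n) ^ ((n : ℝ) / 2) *
        Real.exp (n * (r ^ 2 * ∫ x in Set.Ioi (0 : ℝ), x ^ 2 * M.pr x))) := by
  have hpi := Real.pi_pos
  have hT0 : ∀ l : Fin n → ℝ, 0 ≤ ∏ i, (1 + (r * l i) ^ 2) := fun l => by positivity
  simp only [tilt]
  have e1 : ∀ Y, (∫⁻ l, ENNReal.ofReal (∏ i, M.pr (l i)) * marg (M.K n) (M.τsq n) l *
      ENNReal.ofReal (M.ratio n Y l ^ ((n : ℝ) / 2) * ∏ i, (1 + (r * l i) ^ 2)) ∂posPi n) *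
      ENNReal.ofReal (M.refDens n Y) = ∫⁻ l, ENNReal.ofReal (∏ i, M.pr (l i)) *
      marg (M.K n) (M.τsq n) l *
      ENNReal.ofReal (M.ratio n Y l ^ ((n : ℝ) / 2) * ∏ i, (1 + (r * l i) ^ 2)) *
      ENNReal.ofReal (M.refDens n Y) ∂posPi n := fun Y =>
    (lintegral_mul_const' _ _ ENNReal.ofReal_ne_top).symm
  simp only [e1]
  have hm : AEMeasurable (Function.uncurry fun (Y l : Fin n → ℝ) =>
      ENNReal.ofReal (∏ i, M.pr (l i)) * marg (M.K n) (M.τsq n) l *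
      ENNReal.ofReal (M.ratio n Y l ^ ((n : ℝ) / 2) * ∏ i, (1 + (r * l i) ^ 2)) *
      ENNReal.ofReal (M.refDens n Y)) (volume.prod (posPi n)) := by
    have h1 : AEMeasurable (fun z : (Fin n → ℝ) × (Fin n → ℝ) => ∏ i, M.pr (z.2 i))
        (volume.prod (posPi n)) :=
      (M.aemeasurable_prod_pr n).comp_quasiMeasurePreserving Measure.quasiMeasurePreserving_snd
    have h2 : Measurable fun z : (Fin n → ℝ) × (Fin n → ℝ) => marg (M.K n) (M.τsq n) z.2 :=
      (measurable_marg _ _).comp measurable_snd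
    have h3 := M.measurable_ratio n
    have h4 : Measurable fun z : (Fin n → ℝ) × (Fin n → ℝ) => M.refDens n z.1 :=
      (M.measurable_refDens n).comp measurable_fst
    have h5 : Measurable fun z : (Fin n → ℝ) × (Fin n → ℝ) =>
      ENNReal.ofReal (M.ratio n z.1 z.2 ^ ((n : ℝ) / 2) * ∏ i, (1 + (r * z.2 i) ^ 2)) := by
      fun_prop
    exact ((h1.ennreal_ofReal.mul h2.aemeasurable).mul h5.aemeasurable).mul
      h4.ennreal_ofReal.aemeasurable
  rw [lintegral_lintegral_swap hm]
  have hg : Measurable fun x : ℝ => 1 + (r * x) ^ 2 := by fun_prop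
  have hprior := pow_le_pow_left₀ zero_le (lintegral_pr_quadratic_le hmom r) n
  rw [← M.lintegral_prod_pr hg fun x => by positivity, ← ENNReal.ofReal_pow (Real.exp_pos _).le,
    ← Real.exp_nat_mul] at hprior
  rw [ENNReal.ofReal_mul (by positivity)]
  refine le_trans ?_ (mul_le_mul_right hprior _)
  rw [← lintegral_const_mul' _ _ ENNReal.ofReal_ne_top]
  refine lintegral_mono_ae ?_
  filter_upwards [ae_posPi n] with l hl
  have e2 : ∀ Y, ENNReal.ofReal (∏ i, M.pr (l i)) * marg (M.K n) (M.τsq n) l *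
      ENNReal.ofReal (M.ratio n Y l ^ ((n : ℝ) / 2) * ∏ i, (1 + (r * l i) ^ 2)) *
      ENNReal.ofReal (M.refDens n Y) =
      ENNReal.ofReal (∏ i, M.pr (l i)) * ENNReal.ofReal (∏ i, (1 + (r * l i) ^ 2)) *
      marg (M.K n) (M.τsq n) l *
      ENNReal.ofReal (M.ratio n Y l ^ ((n : ℝ) / 2) * M.refDens n Y) := fun Y => by
    have := ratio_pos ht Y hl
    rw [ENNReal.ofReal_mul (by positivity), ENNReal.ofReal_mul (by positivity)]
    ring
  simp only [e2]
  have h6 : Measurable fun Y =>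
      ENNReal.ofReal (M.ratio n Y l ^ ((n : ℝ) / 2) * M.refDens n Y) := by
    have h3 : Measurable fun Y => M.ratio n Y l :=
      (M.measurable_ratio n).comp (measurable_id.prodMk measurable_const)
    have h4 := M.measurable_refDens n
    fun_prop
  rw [lintegral_const_mul _ h6, mul_assoc, mul_comm (ENNReal.ofReal (_ ^ _))]
  exact mul_le_mul_right (lintegral_ratio_le hn ht hl) _

variable {M} in
lemma sqnorm_mulVec_postMean_le (ht : 0 < M.τsq n) (Y : Fin n → ℝ) :
    sqnorm (M.K n *ᵥ M.postMean n Y) ≤ sqnorm Y := by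
  rcases M.sqnorm_mulVec_postMean ht Y with h0 | ⟨hZ, hjd, hQ, hF⟩
  · rw [h0, mulVec_zero]
    simpa [sqnorm] using sqnorm_nonneg Y
  · have h1 : ∫ p in posSet n, M.jd n Y p.1 p.2.1 p.2.2 * M.expl n Y p.2.2 ≤
        ∫ p in posSet n, M.jd n Y p.1 p.2.1 p.2.2 * sqnorm Y := by
      refine integral_mono_ae hQ (hjd.mul_const _) ?_
      filter_upwards [ae_posSet n] with p hp
      exact mul_le_mul_of_nonneg_left (expl_le ht Y hp.2) (M.jd_nonneg Y p.1 hp.1 hp.2)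
    rw [integral_mul_const, ← Z] at h1
    exact le_of_mul_le_mul_right (by linarith) hZ

/-- The true regression function. -/
def truth (n : ℕ) : Fin n → ℝ := M.K n *ᵥ M.β0 n

/-- Exponentially integrable bound for the posterior Laplace transform. -/
def noise (n : ℕ) (c α δ : ℝ) (Y : Fin n → ℝ) : ℝ :=
  4 * c * sqnorm (M.truth n) + δ * ∑ i, Real.exp (α * (M.K n i ⬝ᵥ (Y - M.truth n)) ^ 2)

variable {M} in
lemma exp_expl_le (ht : 0 < M.τsq n) {c₁ c δ : ℝ} (hc₁ : 0 < c₁)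
    (hlow : ∀ x, c₁ ^ 2 * sqnorm x ≤ sqnorm (M.K n *ᵥ x)) (hc : 0 < c) (hδ : 0 < δ)
    {Y : Fin n → ℝ} (hY : M.a ^ 2 / (M.b * c ^ 2) ≤ sqnorm Y) {l : Fin n → ℝ}
    (hl : ∀ i, 0 < l i) :
    Real.exp (c * M.expl n Y l) ≤ Real.exp (M.noise n c (4 * c / c₁ ^ 2) δ Y) *
      ((∏ i, (1 + (c₁ ^ 2 * M.τsq n / δ * l i) ^ 2)) * M.ratio n Y l ^ (-M.a / 2)) := by
  have h1 := exp_le_exp_mul_ratio_rpow M.ha M.hb hc hY (expl_nonneg ht Y hl) (expl_le ht Y hl)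
  rw [← resid, ← ratio] at h1
  refine h1.trans ?_
  rw [← mul_assoc]
  refine mul_le_mul_of_nonneg_right ?_ (Real.rpow_pos_of_pos (ratio_pos ht Y hl) _).le
  set ε := Y - M.truth n with hε
  have hd := dvec_pos ht hl
  have h2 := fitQ_add_le (M.hK n).isHermitian hd hlow (M.truth n) ε
  rw [hε, add_sub_cancel, ← hε, ← expl] at h2
  have h3 : ∀ i, 4 * c * ((M.K n *ᵥ ε) i ^ 2 / (c₁ ^ 2 + M.dvec n l i)) ≤
      δ * Real.exp (4 * c / c₁ ^ 2 * (M.K n i ⬝ᵥ ε) ^ 2) +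
        Real.log (1 + (c₁ ^ 2 * M.τsq n / δ * l i) ^ 2) := fun i => by
    have hdi := hd i
    have hy1 : c₁ ^ 2 / (c₁ ^ 2 + M.dvec n l i) ≤ 1 :=
      (div_le_one (by positivity)).2 (by linarith)
    have h4 := mul_le_exp_add_log (A := 4 * c / c₁ ^ 2 * (M.K n i ⬝ᵥ ε) ^ 2)
      (y := c₁ ^ 2 / (c₁ ^ 2 + M.dvec n l i)) (by positivity) hy1 hδ
    have h5 : 4 * c / c₁ ^ 2 * (M.K n i ⬝ᵥ ε) ^ 2 * (c₁ ^ 2 / (c₁ ^ 2 + M.dvec n l i)) =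
        4 * c * ((M.K n *ᵥ ε) i ^ 2 / (c₁ ^ 2 + M.dvec n l i)) := by
      rw [show (M.K n *ᵥ ε) i = M.K n i ⬝ᵥ ε from rfl]; field_simp
    rw [h5] at h4
    refine h4.trans (add_le_add_right (Real.log_le_log (by positivity) ?_) _)
    have h6 : c₁ ^ 2 / (c₁ ^ 2 + M.dvec n l i) ≤ c₁ ^ 2 * M.τsq n * l i := by
      have hli := hl i
      have h7 : c₁ ^ 2 / M.dvec n l i = c₁ ^ 2 * M.τsq n * l i := by
        rw [dvec]; field_simp
      rw [← h7]
      exact div_le_div_of_nonneg_left (by positivity) hdi (by nlinarith [sq_nonneg c₁])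
    have h8 : c₁ ^ 2 / (c₁ ^ 2 + M.dvec n l i) / δ ≤ c₁ ^ 2 * M.τsq n / δ * l i := by
      rw [div_mul_eq_mul_div]
      exact div_le_div_of_nonneg_right h6 hδ.le
    have h9 := pow_le_pow_left₀ (by positivity) h8 2
    linarith
  have h4 := Finset.sum_le_sum fun i (_ : i ∈ Finset.univ) => h3 i
  rw [← Finset.mul_sum, Finset.sum_add_distrib, ← Finset.mul_sum,
    ← Real.log_prod fun i _ => (by positivity)] at h4
  rw [← Real.exp_log (show 0 < ∏ i, (1 + (c₁ ^ 2 * M.τsq n / δ * l i) ^ 2) by positivity),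
    ← Real.exp_add]
  refine Real.exp_le_exp.2 ?_
  rw [noise, ← hε]
  nlinarith

/-- Direction along which the likelihood ratio between truth and reference varies. -/
def dir (n : ℕ) : Fin n → ℝ := (√(sqnorm (M.truth n) + 1))⁻¹ • M.truth n

lemma sqnorm_dir_le (n : ℕ) : sqnorm (M.dir n) ≤ 1 := by
  have h := sqnorm_nonneg (M.truth n)
  rw [dir, sqnorm_smul, inv_pow, Real.sq_sqrt (by linarith), inv_mul_le_iff₀ (by linarith)]
  linarith

/-- Upper bound for the log-likelihood ratio of the truth against the reference. -/
def logRatio (n : ℕ) (Y : Fin n → ℝ) : ℝ :=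
  (2 * sqnorm (M.truth n) + 1) / (2 * M.σ0sq) +
    2 * Real.exp (1 / (4 * M.σ0sq) * (M.dir n ⬝ᵥ (Y - M.truth n)) ^ 2)

lemma trueDens_le (Y : Fin n → ℝ) :
    Real.exp (-M.logRatio n Y) * M.trueDens n Y ≤ M.refDens n Y := by
  have hpi := Real.pi_pos
  have hσ := M.hσ0
  rw [trueDens, refDens, mul_left_comm, ← Real.exp_add, ← truth]
  refine mul_le_mul_of_nonneg_left (Real.exp_le_exp.2 ?_) (by positivity)
  set θ := M.truth n with hθ
  obtain ⟨ε, hε⟩ : ∃ ε, ε = Y - θ := ⟨_, rfl⟩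
  have hY : Y = ε + θ := by rw [hε]; abel
  have hθ0 := sqnorm_nonneg θ
  have hs := Real.sq_sqrt (show 0 ≤ sqnorm θ + 1 by linarith)
  have hsp : 0 < √(sqnorm θ + 1) := Real.sqrt_pos.2 (by linarith)
  have hd : ε ⬝ᵥ θ = √(sqnorm θ + 1) * (M.dir n ⬝ᵥ ε) := by
    rw [dir, ← hθ, smul_dotProduct, smul_eq_mul, mul_inv_cancel_left₀ hsp.ne', dotProduct_comm]
  have h1 : 2 * (ε ⬝ᵥ θ) ≤ sqnorm θ + 1 + (M.dir n ⬝ᵥ ε) ^ 2 := by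
    rw [hd]
    nlinarith [sq_nonneg (√(sqnorm θ + 1) - M.dir n ⬝ᵥ ε)]
  have h2 : sqnorm Y = sqnorm ε + 2 * (ε ⬝ᵥ θ) + sqnorm θ := by rw [hY, sqnorm_add]
  have h3 := Real.add_one_le_exp (1 / (4 * M.σ0sq) * (M.dir n ⬝ᵥ ε) ^ 2)
  rw [logRatio, ← hθ, ← hε, h2]
  have h4 : -(sqnorm ε + 2 * (ε ⬝ᵥ θ) + sqnorm θ) / (2 * M.σ0sq) -
      (-((2 * sqnorm θ + 1) / (2 * M.σ0sq) + 2 * (1 / (4 * M.σ0sq) * (M.dir n ⬝ᵥ ε) ^ 2)) +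
        -sqnorm ε / (2 * M.σ0sq)) =
      (sqnorm θ + 1 + (M.dir n ⬝ᵥ ε) ^ 2 - 2 * (ε ⬝ᵥ θ)) / (2 * M.σ0sq) := by
    field_simp; ring
  have h5 : 0 ≤ (sqnorm θ + 1 + (M.dir n ⬝ᵥ ε) ^ 2 - 2 * (ε ⬝ᵥ θ)) / (2 * M.σ0sq) :=
    div_nonneg (by linarith) (by linarith)
  linarith

lemma trueDens_pos (Y : Fin n → ℝ) : 0 < M.trueDens n Y := by
  have hpi := Real.pi_pos
  have hσ := M.hσ0
  unfold trueDens
  positivity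

lemma measurable_trueDens (n : ℕ) : Measurable (M.trueDens n) := by
  have h : Continuous fun Y : Fin n → ℝ => sqnorm (Y - M.K n *ᵥ M.β0 n) :=
    continuous_sqnorm.comp (by fun_prop)
  have h2 := h.measurable
  unfold trueDens
  fun_prop

lemma lintegral_exp_sq_trueDens_le {α : ℝ} (hα : 0 ≤ α) (k : Fin n → ℝ)
    (hk : 2 * α * M.σ0sq * sqnorm k ≤ 1 / 2) :
    ∫⁻ Y, ENNReal.ofReal (Real.exp (α * (k ⬝ᵥ (Y - M.truth n)) ^ 2)) *
      ENNReal.ofReal (M.trueDens n Y) ≤ ENNReal.ofReal √2 := by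
  have hpi := Real.pi_pos
  have hσ := M.hσ0
  have h := lintegral_exp_sq_dotProduct_le hσ hα k hk
  have hp : 0 < (2 * Real.pi * M.σ0sq) ^ (-(n : ℝ) / 2) := by positivity
  have e : ∀ Y, ENNReal.ofReal (Real.exp (α * (k ⬝ᵥ (Y - M.truth n)) ^ 2)) *
      ENNReal.ofReal (M.trueDens n Y) = ENNReal.ofReal ((2 * Real.pi * M.σ0sq) ^ (-(n : ℝ) / 2)) *
      ENNReal.ofReal (Real.exp (α * (k ⬝ᵥ (Y - M.truth n)) ^ 2) *
        Real.exp (-sqnorm (Y - M.truth n) / (2 * M.σ0sq))) := fun Y => by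
    rw [← ENNReal.ofReal_mul (Real.exp_pos _).le, ← ENNReal.ofReal_mul hp.le, trueDens, ← truth]
    congr 1; ring
  simp only [e]
  rw [lintegral_const_mul' _ _ ENNReal.ofReal_ne_top,
    lintegral_sub_right_eq_self (fun ε => ENNReal.ofReal (Real.exp (α * (k ⬝ᵥ ε) ^ 2) *
        Real.exp (-sqnorm ε / (2 * M.σ0sq)))) (M.truth n)]
  refine (mul_le_mul_right h _).trans (le_of_eq ?_)
  rw [← ENNReal.ofReal_mul hp.le, mul_left_comm, ← Real.rpow_add (by positivity)]
  rw [show -(n : ℝ) / 2 + n / 2 = 0 by ring, Real.rpow_zero, mul_one]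

lemma lintegral_trueDens_le (n : ℕ) :
    ∫⁻ Y, ENNReal.ofReal (M.trueDens n Y) ≤ ENNReal.ofReal √2 := by
  have h := M.lintegral_exp_sq_trueDens_le (n := n) le_rfl 0 (by norm_num)
  simpa using h

lemma measurable_exp_sq (n : ℕ) (α : ℝ) (k : Fin n → ℝ) :
    Measurable fun Y => ENNReal.ofReal (Real.exp (α * (k ⬝ᵥ (Y - M.truth n)) ^ 2)) *
      ENNReal.ofReal (M.trueDens n Y) := by
  have h1 : Continuous fun Y : Fin n → ℝ => k ⬝ᵥ (Y - M.truth n) := by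
    simp only [dotProduct]; fun_prop
  have h2 := h1.measurable
  have h3 := M.measurable_trueDens n
  fun_prop

variable {M} in
lemma lintegral_penalty_le {c α δ A : ℝ} (hc : 0 ≤ c) (hα : 0 ≤ α) (hδ : 0 ≤ δ)
    (hA : 0 ≤ A) (hrow : ∀ i, 2 * α * M.σ0sq * sqnorm (M.K n i) ≤ 1 / 2) :
    ∫⁻ Y, ENNReal.ofReal (A + (M.noise n c α δ Y + M.logRatio n Y)) *
      ENNReal.ofReal (M.trueDens n Y) ≤
      ENNReal.ofReal (√2 * (A + 4 * c * sqnorm (M.truth n) +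
        (2 * sqnorm (M.truth n) + 1) / (2 * M.σ0sq) + n * δ + 2)) := by
  have hσ := M.hσ0
  have hθ := sqnorm_nonneg (M.truth n)
  set B := A + 4 * c * sqnorm (M.truth n) + (2 * sqnorm (M.truth n) + 1) / (2 * M.σ0sq) with hB
  have hB0 : 0 ≤ B := by positivity
  have e : ∀ Y, ENNReal.ofReal (A + (M.noise n c α δ Y + M.logRatio n Y)) *
      ENNReal.ofReal (M.trueDens n Y) = ENNReal.ofReal B * ENNReal.ofReal (M.trueDens n Y) +
      (ENNReal.ofReal δ * ∑ i, ENNReal.ofReal (Real.exp (α * (M.K n i ⬝ᵥ (Y - M.truth n)) ^ 2)) *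
        ENNReal.ofReal (M.trueDens n Y) +
      ENNReal.ofReal 2 * (ENNReal.ofReal (Real.exp (1 / (4 * M.σ0sq) *
        (M.dir n ⬝ᵥ (Y - M.truth n)) ^ 2)) * ENNReal.ofReal (M.trueDens n Y))) := fun Y => by
    rw [← Finset.sum_mul, ← ENNReal.ofReal_sum_of_nonneg fun i _ => (Real.exp_pos _).le,
      ← mul_assoc, ← mul_assoc, ← add_mul, ← add_mul, ← ENNReal.ofReal_mul hδ,
      ← ENNReal.ofReal_mul zero_le_two, ← ENNReal.ofReal_add (by positivity) (by positivity),
      ← ENNReal.ofReal_add hB0 (by positivity), noise, logRatio]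
    congr 2; ring
  simp only [e]
  have hm := fun k α => M.measurable_exp_sq n α k
  have hp := (M.measurable_trueDens n).ennreal_ofReal
  rw [lintegral_add_left (hp.const_mul _), lintegral_add_right _ ((hm _ _).const_mul _),
    lintegral_const_mul' _ _ ENNReal.ofReal_ne_top, lintegral_const_mul' _ _ ENNReal.ofReal_ne_top,
    lintegral_const_mul' _ _ ENNReal.ofReal_ne_top, lintegral_finsetSum _ fun i _ => hm (M.K n i) α]
  have h1 := M.lintegral_trueDens_le n
  have h2 := fun i => M.lintegral_exp_sq_trueDens_le hα (M.K n i) (hrow i)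
  have h3 := M.lintegral_exp_sq_trueDens_le (α := 1 / (4 * M.σ0sq)) (by positivity) (M.dir n) (by
    have h4 : 2 * (1 / (4 * M.σ0sq)) * M.σ0sq = 1 / 2 := by field_simp; norm_num
    rw [h4]
    linarith [M.sqnorm_dir_le n])
  refine (add_le_add (mul_le_mul_right h1 _) (add_le_add (mul_le_mul_right
    (Finset.sum_le_sum fun i _ => h2 i) _) (mul_le_mul_right h3 _))).trans (le_of_eq ?_)
  rw [Finset.sum_const, Finset.card_univ, Fintype.card_fin, nsmul_eq_mul, ← mul_assoc, ← add_mul,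
    ← add_mul, ← ENNReal.ofReal_natCast, ← ENNReal.ofReal_mul hδ,
    ← ENNReal.ofReal_add (by positivity) (by positivity),
    ← ENNReal.ofReal_add (by positivity) (by positivity), ← ENNReal.ofReal_mul (by positivity)]
  congr 1; ring

variable {M} in
/-- Bound for the expected squared norm of the fitted posterior mean. -/
lemma lintegral_sqnorm_postMean_le (hn : n ≠ 0) (ht : 0 < M.τsq n) (hmom : M.Moment4)
    {c₁ c₂ c δ : ℝ} (hc₁ : 0 < c₁)
    (hlow : ∀ x, c₁ ^ 2 * sqnorm x ≤ sqnorm (M.K n *ᵥ x))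
    (hup : ∀ x, sqnorm (M.K n *ᵥ x) ≤ c₂ ^ 2 * sqnorm x)
    (hrow : ∀ i, sqnorm (M.K n i) ≤ c₂ ^ 2) (hc : 0 < c)
    (hcc : 16 * c * M.σ0sq * c₂ ^ 2 ≤ c₁ ^ 2) (hδ : 0 < δ) :
    ∫⁻ Y, ENNReal.ofReal (c * sqnorm (M.K n *ᵥ M.postMean n Y)) *
      ENNReal.ofReal (M.trueDens n Y) ≤
      ENNReal.ofReal (√2 * (c * (M.a ^ 2 / (M.b * c ^ 2)) +
        n * (c₂ ^ 2 * M.τsq n / 2 * ∫ x in Set.Ioi (0 : ℝ), x * M.pr x) +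
        4 * c * sqnorm (M.truth n) +
        (2 * sqnorm (M.truth n) + 1) / (2 * M.σ0sq) + n * δ + 2) +
        Real.exp (n * ((c₁ ^ 2 * M.τsq n / δ) ^ 2 *
          ∫ x in Set.Ioi (0 : ℝ), x ^ 2 * M.pr x))) := by
  have hpi := Real.pi_pos
  have hσ := M.hσ0
  have ha := M.ha
  have hb := M.hb
  have hθ := sqnorm_nonneg (M.truth n)
  set t0 := M.a ^ 2 / (M.b * c ^ 2) with ht0
  set C1 := n * (c₂ ^ 2 * M.τsq n / 2 * ∫ x in Set.Ioi (0 : ℝ), x * M.pr x) with hC1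
  set C2 := n * ((c₁ ^ 2 * M.τsq n / δ) ^ 2 * ∫ x in Set.Ioi (0 : ℝ), x ^ 2 * M.pr x) with hC2
  set α := 4 * c / c₁ ^ 2 with hα
  have ht00 : 0 ≤ t0 := by positivity
  have hC10 : 0 ≤ C1 := by
    have : 0 ≤ ∫ x in Set.Ioi (0 : ℝ), x * M.pr x := setIntegral_nonneg measurableSet_Ioi
      fun x hx => mul_nonneg (le_of_lt hx) (M.hpr_nonneg x)
    positivity
  obtain ⟨D, hD⟩ : ∃ D, D = (2 * Real.pi * M.τsq n) ^ ((n : ℝ) / 2) := ⟨_, rfl⟩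
  have hDp : 0 < D := by rw [hD]; positivity
  have hmass := mass_ge ht hmom hup
  rw [← hC1, ← hD] at hmass
  have hnoise : ∀ Y, 0 ≤ M.noise n c α δ Y := fun Y => by unfold noise; positivity
  have hlog : ∀ Y, 0 ≤ M.logRatio n Y := fun Y => by unfold logRatio; positivity
  let T : (Fin n → ℝ) → ℝ := fun l => ∏ i, (1 + (c₁ ^ 2 * M.τsq n / δ * l i) ^ 2)
  have hT : Measurable T := by fun_prop
  have hT0 : ∀ l, 0 ≤ T l := fun l => by positivity
  have hpt : ∀ Y, ENNReal.ofReal D * ENNReal.ofReal (c * sqnorm (M.K n *ᵥ M.postMean n Y)) ≤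
      ENNReal.ofReal D * ENNReal.ofReal (c * t0 + C1 + (M.noise n c α δ Y + M.logRatio n Y)) +
        ENNReal.ofReal (Real.exp (-M.logRatio n Y)) * M.tilt n T Y := fun Y => by
    have hnY := hnoise Y
    have hlY := hlog Y
    rcases lt_or_ge (sqnorm Y) t0 with hY | hY
    · refine le_add_of_le_of_nonneg (mul_le_mul_right (ENNReal.ofReal_le_ofReal ?_) _) zero_le
      have := mul_le_mul_of_nonneg_left ((sqnorm_mulVec_postMean_le ht Y).trans hY.le) hc.le
      linarith
    · have h1 := postMean_bound ht Y hT hT0 hc.le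
        (m := C1 + (M.noise n c α δ Y + M.logRatio n Y)) (by positivity) hmass
        fun l hl => exp_expl_le ht hc₁ hlow hc hδ hY hl
      rw [show M.noise n c α δ Y - (C1 + (M.noise n c α δ Y + M.logRatio n Y)) =
        -C1 + -M.logRatio n Y by ring, Real.exp_add, ENNReal.ofReal_mul hDp.le,
        ENNReal.ofReal_mul (Real.exp_pos _).le] at h1
      have h2 : ENNReal.ofReal (Real.exp (-C1)) *
          (ENNReal.ofReal D * ENNReal.ofReal (c * sqnorm (M.K n *ᵥ M.postMean n Y))) ≤
          ENNReal.ofReal (Real.exp (-C1)) * (ENNReal.ofReal D *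
          ENNReal.ofReal (C1 + (M.noise n c α δ Y + M.logRatio n Y)) +
          ENNReal.ofReal (Real.exp (-M.logRatio n Y)) * M.tilt n T Y) := by
        refine le_trans (le_of_eq ?_) (h1.trans (le_of_eq ?_)) <;> ring
      refine ((ENNReal.mul_le_mul_iff_right (ENNReal.ofReal_pos.2 (Real.exp_pos _)).ne'
        ENNReal.ofReal_ne_top).1 h2).trans ?_
      gcongr
      have : 0 ≤ c * t0 := by positivity
      linarith
  have hα0 : 0 ≤ α := by positivity
  have hpen := lintegral_penalty_le (M := M) (n := n) (A := c * t0 + C1) hc.le hα0 hδ.le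
    (by positivity) (fun i => by
      have h1 : α * M.σ0sq * c₂ ^ 2 ≤ 1 / 4 := by
        rw [hα, div_mul_eq_mul_div, div_mul_eq_mul_div, div_le_iff₀ (by positivity)]
        linarith
      have h2 := mul_le_mul_of_nonneg_left (hrow i) (mul_nonneg hα0 hσ.le)
      linarith)
  have htilt := lintegral_tilt_le hn ht hmom (c₁ ^ 2 * M.τsq n / δ)
  rw [← hC2, ← hD] at htilt
  have hmp : Measurable fun Y => ENNReal.ofReal
      (c * t0 + C1 + (M.noise n c α δ Y + M.logRatio n Y)) * ENNReal.ofReal (M.trueDens n Y) := by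
    have h1 : ∀ k : Fin n → ℝ, Measurable fun Y : Fin n → ℝ => k ⬝ᵥ (Y - M.truth n) := fun k => by
      simp only [dotProduct]; fun_prop
    have h2 := M.measurable_trueDens n
    have h3 : Measurable (M.noise n c α δ) := by
      have := fun i => h1 (M.K n i)
      unfold noise
      fun_prop
    have h4 : Measurable (M.logRatio n) := by
      have := h1 (M.dir n)
      unfold logRatio
      fun_prop
    fun_prop
  have hmain : ENNReal.ofReal D * ∫⁻ Y, ENNReal.ofReal (c * sqnorm (M.K n *ᵥ M.postMean n Y)) *
      ENNReal.ofReal (M.trueDens n Y) ≤ ENNReal.ofReal D * ENNReal.ofReal (√2 * (c * t0 + C1 +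
        4 * c * sqnorm (M.truth n) +
        (2 * sqnorm (M.truth n) + 1) / (2 * M.σ0sq) + n * δ + 2) + Real.exp C2) := by
    calc _ ≤ ∫⁻ Y, (ENNReal.ofReal D * (ENNReal.ofReal
          (c * t0 + C1 + (M.noise n c α δ Y + M.logRatio n Y)) * ENNReal.ofReal (M.trueDens n Y)) +
          M.tilt n T Y * ENNReal.ofReal (M.refDens n Y)) := by
          rw [← lintegral_const_mul' _ _ ENNReal.ofReal_ne_top]
          refine lintegral_mono fun Y => ?_
          have h1 := mul_le_mul_left (hpt Y) (ENNReal.ofReal (M.trueDens n Y))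
          have h2 := ENNReal.ofReal_le_ofReal (M.trueDens_le Y)
          rw [ENNReal.ofReal_mul (Real.exp_pos _).le] at h2
          calc _ = ENNReal.ofReal D * ENNReal.ofReal (c * sqnorm (M.K n *ᵥ M.postMean n Y)) *
                ENNReal.ofReal (M.trueDens n Y) := by ring
            _ ≤ _ := h1
            _ = ENNReal.ofReal D * (ENNReal.ofReal
                (c * t0 + C1 + (M.noise n c α δ Y + M.logRatio n Y)) *
                ENNReal.ofReal (M.trueDens n Y)) + M.tilt n T Y *
                (ENNReal.ofReal (Real.exp (-M.logRatio n Y)) *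
                ENNReal.ofReal (M.trueDens n Y)) := by ring
            _ ≤ _ := by gcongr
      _ = ENNReal.ofReal D * (∫⁻ Y, ENNReal.ofReal
          (c * t0 + C1 + (M.noise n c α δ Y + M.logRatio n Y)) * ENNReal.ofReal (M.trueDens n Y)) +
          ∫⁻ Y, M.tilt n T Y * ENNReal.ofReal (M.refDens n Y) := by
          rw [lintegral_add_left (hmp.const_mul _), lintegral_const_mul' _ _ ENNReal.ofReal_ne_top]
      _ ≤ _ := add_le_add (mul_le_mul_right hpen _) htilt
      _ = _ := by
          rw [ENNReal.ofReal_mul hDp.le (q := Real.exp C2), ← mul_add, ← ENNReal.ofReal_add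
            (by positivity) (Real.exp_pos _).le]
  exact (ENNReal.mul_le_mul_iff_right (ENNReal.ofReal_pos.2 hDp).ne' ENNReal.ofReal_ne_top).1 hmain

variable {M} in
lemma E0_le {c R : ℝ} (hc : 0 < c) (hR : 0 ≤ R)
    (h : ∫⁻ Y, ENNReal.ofReal (c * sqnorm (M.K n *ᵥ M.postMean n Y)) *
      ENNReal.ofReal (M.trueDens n Y) ≤ ENNReal.ofReal R) :
    M.E0 n (fun Y => sqnorm (M.K n *ᵥ M.postMean n Y - M.K n *ᵥ M.β0 n)) ≤
      2 / c * R + 2 * sqnorm (M.truth n) * √2 := by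
  have hθ := sqnorm_nonneg (M.truth n)
  have hle : ∀ Y, ENNReal.ofReal (sqnorm (M.K n *ᵥ M.postMean n Y - M.K n *ᵥ M.β0 n) *
      M.trueDens n Y) ≤ ENNReal.ofReal (2 / c) * (ENNReal.ofReal
        (c * sqnorm (M.K n *ᵥ M.postMean n Y)) * ENNReal.ofReal (M.trueDens n Y)) +
      ENNReal.ofReal (2 * sqnorm (M.truth n)) * ENNReal.ofReal (M.trueDens n Y) := fun Y => by
    have hp := (M.trueDens_pos Y).le
    have hF := sqnorm_nonneg (M.K n *ᵥ M.postMean n Y)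
    rw [← ENNReal.ofReal_mul (by positivity), ← ENNReal.ofReal_mul (by positivity),
      ← ENNReal.ofReal_mul (by positivity), ← ENNReal.ofReal_add (by positivity) (by positivity)]
    refine ENNReal.ofReal_le_ofReal ?_
    have h1 := sqnorm_sub_le (M.K n *ᵥ M.postMean n Y) (M.truth n)
    have h2 : 2 / c * (c * sqnorm (M.K n *ᵥ M.postMean n Y) * M.trueDens n Y) =
        2 * sqnorm (M.K n *ᵥ M.postMean n Y) * M.trueDens n Y := by field_simp
    rw [h2, ← add_mul]
    exact mul_le_mul_of_nonneg_right h1 hp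
  have hl : ∫⁻ Y, ENNReal.ofReal (sqnorm (M.K n *ᵥ M.postMean n Y - M.K n *ᵥ M.β0 n) *
      M.trueDens n Y) ≤ ENNReal.ofReal (2 / c * R + 2 * sqnorm (M.truth n) * √2) := by
    refine (lintegral_mono hle).trans ?_
    rw [lintegral_add_right _ ((M.measurable_trueDens n).ennreal_ofReal.const_mul _),
      lintegral_const_mul' _ _ ENNReal.ofReal_ne_top, lintegral_const_mul' _ _
      ENNReal.ofReal_ne_top, ENNReal.ofReal_add (by positivity) (by positivity),
      ENNReal.ofReal_mul (p := 2 / c) (by positivity),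
      ENNReal.ofReal_mul (p := 2 * sqnorm (M.truth n)) (by positivity)]
    exact add_le_add (mul_le_mul_right h _) (mul_le_mul_right (M.lintegral_trueDens_le n) _)
  have h0 : 0 ≤ 2 / c * R + 2 * sqnorm (M.truth n) * √2 := by positivity
  rw [E0]
  by_cases hi : Integrable fun Y =>
      sqnorm (M.K n *ᵥ M.postMean n Y - M.K n *ᵥ M.β0 n) * M.trueDens n Y
  · rw [integral_eq_lintegral_of_nonneg_ae (ae_of_all _ fun Y =>
      mul_nonneg (sqnorm_nonneg _) (M.trueDens_pos Y).le) hi.aestronglyMeasurable]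
    exact ENNReal.toReal_le_of_le_ofReal h0 hl
  · rw [integral_undef hi]
    exact h0

end Model

end RVM

namespace RVM.Model

variable (M : Model) {n : ℕ}

lemma sqnorm_β0_le {M₀ : ℝ} (h : ∀ i : Fin n, |M.β0 n i| < M₀) :
    sqnorm (M.β0 n) ≤ M₀ ^ 2 * M.q n := by
  classical
  have hq : (M.q n : ℝ) = ∑ i, if M.β0 n i ≠ 0 then (1 : ℝ) else 0 := by
    rw [q, Set.ncard_eq_toFinset_card', Finset.sum_boole, Set.toFinset_ofPred]
  rw [sqnorm_eq_sum, hq, Finset.mul_sum]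
  refine Finset.sum_le_sum fun i _ => ?_
  split_ifs with h0
  · rw [mul_one, ← sq_abs]
    exact pow_le_pow_left₀ (abs_nonneg _) (h i).le 2
  · rw [not_not.1 h0]; simp

end RVM.Model

open RVM Filter

/-- **Theorem 1.** Under (A1)–(A3), if `τₙ² ⪯ n^{−3/2} qₙ` and `∫ λ⁴ π(λ²) dλ² < ∞`, then
`E₀ ‖E(Kₙβₙ | Yₙ) − Kₙβ₀ₙ‖² ⪯ qₙ` as `n → ∞`. -/
theorem theorem1 (M : RVM.Model) (hτpos : ∀ n, 0 < M.τsq n)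
    (hA1 : M.CondA1) (hA2 : M.CondA2) (hA3 : M.CondA3)
    (hτ : ∃ C > (0 : ℝ), ∃ N : ℕ, ∀ n ≥ N,
      M.τsq n ≤ C * ((n : ℝ) ^ (-(3 : ℝ) / 2) * M.q n))
    (hmom : M.Moment4) :
    ∃ C > (0 : ℝ), ∃ N : ℕ, ∀ n ≥ N,
      M.E0 n (fun Y => sqnorm (M.K n *ᵥ M.postMean n Y - M.K n *ᵥ M.β0 n)) ≤
        C * M.q n := by
  obtain ⟨c₁, c₂, hc₁, hc₁₂, N₁, hN₁⟩ := hA1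
  obtain ⟨M₀, hM₀⟩ := hA2
  obtain ⟨C, hC, N₂, hN₂⟩ := hτ
  have hc₂ : 0 < c₂ := hc₁.trans_le hc₁₂
  have hσ := M.hσ0
  have ha := M.ha
  have hb := M.hb
  obtain ⟨c, hc⟩ : ∃ c, c = c₁ ^ 2 / (16 * M.σ0sq * c₂ ^ 2) := ⟨_, rfl⟩
  have hc0 : 0 < c := by rw [hc]; positivity
  have hcc : 16 * c * M.σ0sq * c₂ ^ 2 ≤ c₁ ^ 2 := by
    rw [hc]; apply le_of_eq; field_simp
  obtain ⟨m1, hm1⟩ : ∃ m, m = ∫ x in Set.Ioi (0 : ℝ), x * M.pr x := ⟨_, rfl⟩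
  obtain ⟨m2, hm2⟩ : ∃ m, m = ∫ x in Set.Ioi (0 : ℝ), x ^ 2 * M.pr x := ⟨_, rfl⟩
  have hm10 : 0 ≤ m1 := hm1 ▸ setIntegral_nonneg measurableSet_Ioi
    fun x hx => mul_nonneg (le_of_lt hx) (M.hpr_nonneg x)
  have hm20 : 0 ≤ m2 := hm2 ▸ setIntegral_nonneg measurableSet_Ioi
    fun x _ => mul_nonneg (sq_nonneg x) (M.hpr_nonneg x)
  obtain ⟨B, hB⟩ : ∃ B, B = c₂ ^ 2 * M₀ ^ 2 := ⟨_, rfl⟩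
  have hB0 : 0 ≤ B := by rw [hB]; positivity
  obtain ⟨t0, ht0⟩ : ∃ t0, t0 = c * (M.a ^ 2 / (M.b * c ^ 2)) := ⟨_, rfl⟩
  have ht00 : 0 ≤ t0 := by rw [ht0]; positivity
  obtain ⟨R, hR⟩ : ∃ R, R = √2 * (t0 + c₂ ^ 2 * C / 2 * m1 + 4 * c * B +
    (2 * B + 1) / (2 * M.σ0sq) + 1 + 2) + Real.exp (c₁ ^ 4 * C ^ 2 * m2) := ⟨_, rfl⟩
  have hR0 : 0 < R := by rw [hR]; positivity
  refine ⟨2 / c * R + 2 * B * √2, by positivity, max (max N₁ N₂) 1, fun n hn => ?_⟩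
  have hn1 : N₁ ≤ n := le_trans (le_max_left _ _) (le_trans (le_max_left _ _) hn)
  have hn2 : N₂ ≤ n := le_trans (le_max_right _ _) (le_trans (le_max_left _ _) hn)
  have hn0 : n ≠ 0 := Nat.one_le_iff_ne_zero.1 (le_trans (le_max_right _ _) hn)
  have hnR : (1 : ℝ) ≤ n := by exact_mod_cast Nat.one_le_iff_ne_zero.2 hn0
  have hnp : (0 : ℝ) < n := by linarith
  obtain ⟨hK1, hK2⟩ := hN₁ n hn1
  have ht := hτpos n
  have hτn := hN₂ n hn2
  have hq1 : (1 : ℝ) ≤ M.q n := by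
    have : M.q n ≠ 0 := fun h => by
      rw [h] at hτn
      simp only [Nat.cast_zero, mul_zero] at hτn
      linarith
    exact_mod_cast Nat.one_le_iff_ne_zero.2 this
  have hqp : (0 : ℝ) < M.q n := by linarith
  have hup := fun x => sqnorm_mulVec_le (M.hK n) hc₂ hK2 x
  have hθ : sqnorm (M.truth n) ≤ B * M.q n := by
    refine (hup _).trans ?_
    rw [hB, mul_assoc]
    exact mul_le_mul_of_nonneg_left (M.sqnorm_β0_le fun i => hM₀ n i) (by positivity)
  have hθ0 := sqnorm_nonneg (M.truth n)
  have hmain := Model.lintegral_sqnorm_postMean_le hn0 ht hmom hc₁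
    (fun x => sqnorm_mulVec_ge hc₁ hK1 x) hup
    (fun i => sqnorm_row_le (M.hK n).isHermitian hup i) hc0 hcc
    (δ := (M.q n : ℝ) / n) (by positivity)
  rw [← hm1, ← hm2, ← ht0] at hmain
  have hpow : (n : ℝ) ^ (-(3 : ℝ) / 2) * n ≤ 1 := by
    rw [← Real.rpow_add_one hnp.ne']
    exact Real.rpow_le_one_of_one_le_of_nonpos hnR (by norm_num)
  have hpow2 : ((n : ℝ) ^ (-(3 : ℝ) / 2)) ^ 2 * n ^ 3 = 1 := by
    rw [← Real.rpow_natCast (n : ℝ) 3, ← Real.rpow_natCast _ 2, ← Real.rpow_mul hnp.le,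
      ← Real.rpow_add hnp]
    norm_num
  have hC1 : n * (c₂ ^ 2 * M.τsq n / 2 * m1) ≤ c₂ ^ 2 * C / 2 * m1 * M.q n := by
    have h1 : n * M.τsq n ≤ C * M.q n := by
      calc n * M.τsq n ≤ n * (C * ((n : ℝ) ^ (-(3 : ℝ) / 2) * M.q n)) :=
            mul_le_mul_of_nonneg_left hτn hnp.le
        _ = C * M.q n * ((n : ℝ) ^ (-(3 : ℝ) / 2) * n) := by ring
        _ ≤ C * M.q n := mul_le_of_le_one_right (by positivity) hpow
    have := mul_le_mul_of_nonneg_left h1 (show 0 ≤ c₂ ^ 2 / 2 * m1 by positivity)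
    linarith
  have hC2 : n * ((c₁ ^ 2 * M.τsq n / (M.q n / n)) ^ 2 * m2) ≤ c₁ ^ 4 * C ^ 2 * m2 := by
    have h1 : M.τsq n ^ 2 ≤ (C * ((n : ℝ) ^ (-(3 : ℝ) / 2) * M.q n)) ^ 2 :=
      pow_le_pow_left₀ ht.le hτn 2
    have h2 : M.τsq n ^ 2 * n ^ 3 / (M.q n : ℝ) ^ 2 ≤ C ^ 2 := by
      rw [div_le_iff₀ (by positivity)]
      calc _ ≤ (C * ((n : ℝ) ^ (-(3 : ℝ) / 2) * M.q n)) ^ 2 * n ^ 3 :=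
            mul_le_mul_of_nonneg_right h1 (by positivity)
        _ = C ^ 2 * (M.q n : ℝ) ^ 2 * (((n : ℝ) ^ (-(3 : ℝ) / 2)) ^ 2 * n ^ 3) := by ring
        _ = _ := by rw [hpow2, mul_one]
    have h3 : n * ((c₁ ^ 2 * M.τsq n / (M.q n / n)) ^ 2 * m2) =
        c₁ ^ 4 * m2 * (M.τsq n ^ 2 * n ^ 3 / (M.q n : ℝ) ^ 2) := by field_simp
    rw [h3]
    have := mul_le_mul_of_nonneg_left h2 (show 0 ≤ c₁ ^ 4 * m2 by positivity)
    linarith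
  have hbound : √2 * (t0 + n * (c₂ ^ 2 * M.τsq n / 2 * m1) + 4 * c * sqnorm (M.truth n) +
      (2 * sqnorm (M.truth n) + 1) / (2 * M.σ0sq) + n * (M.q n / n) + 2) +
      Real.exp (n * ((c₁ ^ 2 * M.τsq n / (M.q n / n)) ^ 2 * m2)) ≤ R * M.q n := by
    have h1 : t0 ≤ t0 * M.q n := le_mul_of_one_le_right ht00 hq1
    have h2 : 4 * c * sqnorm (M.truth n) ≤ 4 * c * B * M.q n := by
      have := mul_le_mul_of_nonneg_left hθ (show 0 ≤ 4 * c by positivity)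
      linarith
    have h3 : (2 * sqnorm (M.truth n) + 1) / (2 * M.σ0sq) ≤
        (2 * B + 1) / (2 * M.σ0sq) * M.q n := by
      rw [div_mul_eq_mul_div]
      refine div_le_div_of_nonneg_right ?_ (by positivity)
      linarith
    have h4 : n * ((M.q n : ℝ) / n) = M.q n := by field_simp
    have h5 := Real.exp_le_exp.2 hC2
    have h6 : Real.exp (c₁ ^ 4 * C ^ 2 * m2) ≤ Real.exp (c₁ ^ 4 * C ^ 2 * m2) * M.q n :=
      le_mul_of_one_le_right (Real.exp_pos _).le hq1
    have h7 := mul_le_mul_of_nonneg_left (show t0 + n * (c₂ ^ 2 * M.τsq n / 2 * m1) +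
      4 * c * sqnorm (M.truth n) + (2 * sqnorm (M.truth n) + 1) / (2 * M.σ0sq) +
      n * ((M.q n : ℝ) / n) + 2 ≤ (t0 + c₂ ^ 2 * C / 2 * m1 + 4 * c * B +
      (2 * B + 1) / (2 * M.σ0sq) + 1 + 2) * M.q n by linarith) (Real.sqrt_nonneg 2)
    rw [hR, add_mul, mul_assoc √2]
    linarith
  refine (Model.E0_le hc0 (by positivity)
    (hmain.trans (ENNReal.ofReal_le_ofReal hbound))).trans ?_
  have h8 := mul_le_mul_of_nonneg_right hθ (Real.sqrt_nonneg 2)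
  linarith
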